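/- arXiv:1512.09047 — 3 statements merged into one kernel-verified Lean document; each statement's English description precedes it below -/
import Mathlib

section
/- For any separable state ρ_AB = Σᵢ pᵢ ρᵢ ⊗ σᵢ (a finite convex combination of product states) on a finite-dimensional bipartite system, the quantum mutual information satisfies I(A:B)_ρ ≤ min{H(ρ_A), H(ρ_B)}. -/
set_option maxHeartbeats 1000000

open Matrix Real
open scoped ComplexOrder Kronecker

noncomputable section

/-- The von Neumann entropy of a (Hermitian) matrix, via its eigenvalues. -/
def vnEntropy {n : Type*} [Fintype n] [DecidableEq n] (A : Matrix n n ℂ) : ℝ :=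
  if h : A.IsHermitian then ∑ i, Real.negMulLog (h.eigenvalues i) else 0

/-- A density operator: positive semidefinite with unit trace. -/
def IsState {n : Type*} [Fintype n] (A : Matrix n n ℂ) : Prop := A.PosSemidef ∧ A.trace = 1

variable {α β : Type*} [Fintype α] [DecidableEq α] [Fintype β] [DecidableEq β]

/-- Partial trace over the second factor: the marginal ρ_A. -/
def ptraceB (ρ : Matrix (α × β) (α × β) ℂ) : Matrix α α ℂ :=
  fun i j => ∑ k, ρ (i, k) (j, k)

/-- Partial trace over the first factor: the marginal ρ_B. -/
def ptraceA (ρ : Matrix (α × β) (α × β) ℂ) : Matrix β β ℂ :=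
  fun i j => ∑ k, ρ (k, i) (k, j)

/-- Quantum mutual information I(A:B) = H(ρ_A) + H(ρ_B) - H(ρ_AB). -/
def mutualInfo (ρ : Matrix (α × β) (α × β) ℂ) : ℝ :=
  vnEntropy (ptraceB ρ) + vnEntropy (ptraceA ρ) - vnEntropy ρ

lemma core_ineq {m l n : Type*} [Fintype m] [Fintype l] [Fintype n]
    [DecidableEq m] [DecidableEq l] [DecidableEq n]
    (W : Matrix (m × l) n ℂ) (r : n → ℝ) (a : m → ℝ)
    (hr : ∀ j, 0 ≤ r j) (ha : ∀ k, 0 ≤ a k)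
    (hW : ∀ j, ∑ k, ∑ b, Complex.normSq (W (k, b) j) = 1)
    (h1 : ∀ z : m × l → ℂ, ∑ j, r j * Complex.normSq (∑ q, star (W q j) * z q)
      ≤ ∑ q : m × l, a q.1 * Complex.normSq (z q))
    (h2 : ∀ k, ∑ j, r j * ∑ b, Complex.normSq (W (k, b) j) = a k) :
    ∑ k, negMulLog (a k) ≤ ∑ j, negMulLog (r j) := by
  set c : n → m → ℝ := fun j k => ∑ b, Complex.normSq (W (k, b) j) with hc
  have hc0 : ∀ j k, 0 ≤ c j k := fun j k => Finset.sum_nonneg fun b _ => Complex.normSq_nonneg _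
  have hL : ∑ k, negMulLog (a k) = ∑ j, r j * (- ∑ k, c j k * Real.log (a k)) := by
    have : ∀ k, negMulLog (a k) = ∑ j, r j * (-(c j k * Real.log (a k))) := by
      intro k
      rw [negMulLog, ← h2 k, h2 k, ← h2 k, neg_mul, Finset.sum_mul, ← Finset.sum_neg_distrib]
      refine Finset.sum_congr rfl fun j _ => ?_
      rw [h2 k]; ring
    simp_rw [this]
    rw [Finset.sum_comm]
    simp_rw [← Finset.mul_sum, Finset.sum_neg_distrib]
  rw [hL]
  refine Finset.sum_le_sum fun j _ => ?_
  rcases (hr j).eq_or_lt with h | hrj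
  · rw [← h]; simp
  have hz : ∀ k, a k = 0 → c j k = 0 := by
    intro k hk
    have := h2 k
    rw [hk, Finset.sum_eq_zero_iff_of_nonneg (fun j _ => mul_nonneg (hr j) (hc0 j k))] at this
    have := this j (Finset.mem_univ _)
    rcases mul_eq_zero.1 this with h | h
    · exact absurd h hrj.ne'
    · exact h
  set s : ℝ := ∑ k, c j k / a k with hs
  have hs0 : 0 ≤ s := Finset.sum_nonneg fun k _ => div_nonneg (hc0 j k) (ha k)
  have hs1 : r j * s ≤ 1 := by
    have key := h1 (fun q => W q j / (a q.1 : ℂ))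
    have e1 : ∑ q : m × l, a q.1 * Complex.normSq (W q j / (a q.1 : ℂ)) = s := by
      rw [Fintype.sum_prod_type, hs]
      refine Finset.sum_congr rfl fun k _ => ?_
      rw [hc]
      simp only [Finset.sum_div]
      refine Finset.sum_congr rfl fun b _ => ?_
      rw [Complex.normSq_div, Complex.normSq_ofReal]
      by_cases h : a k = 0
      · simp [h]
      · field_simp
    have e2 : (∑ q : m × l, star (W q j) * (W q j / (a q.1 : ℂ))) = (s : ℂ) := by
      rw [Fintype.sum_prod_type, hs]
      push_cast
      refine Finset.sum_congr rfl fun k _ => ?_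
      rw [hc]
      push_cast
      simp only [Finset.sum_div]
      refine Finset.sum_congr rfl fun b _ => ?_
      rw [Complex.normSq_eq_conj_mul_self, mul_div_assoc]; rfl
    rw [e1] at key
    have h3 : r j * Complex.normSq (∑ q : m × l, star (W q j) * (W q j / (a q.1 : ℂ))) ≤ s :=
      le_trans (Finset.single_le_sum (f := fun j' => r j' * Complex.normSq (∑ q : m × l, star (W q j') * (W q j / (a q.1 : ℂ)))) (fun j' _ => mul_nonneg (hr j') (Complex.normSq_nonneg _)) (Finset.mem_univ j)) key
    rw [e2, Complex.normSq_ofReal] at h3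
    rcases hs0.eq_or_lt with h | h
    · rw [← h]; simp
    · by_contra hcon
      push Not at hcon
      nlinarith
  have hmain : ∑ k, c j k * (Real.log (r j) - Real.log (a k)) ≤ ∑ k, (r j * (c j k / a k) - c j k) := by
    refine Finset.sum_le_sum fun k _ => ?_
    rcases (ha k).eq_or_lt with h | h
    · rw [hz k h.symm]; simp
    · rw [← Real.log_div hrj.ne' h.ne']
      have := Real.log_le_sub_one_of_pos (div_pos hrj h)
      calc _ ≤ c j k * (r j / a k - 1) := mul_le_mul_of_nonneg_left this (hc0 j k)
        _ = _ := by ring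
  have hWj : ∑ k, c j k = 1 := hW j
  rw [Finset.sum_sub_distrib, ← Finset.mul_sum, hWj] at hmain
  simp_rw [mul_sub] at hmain
  rw [Finset.sum_sub_distrib, ← Finset.sum_mul, hWj] at hmain
  rw [negMulLog, neg_mul, ← mul_neg]
  refine mul_le_mul_of_nonneg_left ?_ hrj.le
  linarith

lemma spectral_mul {n : Type*} [Fintype n] [DecidableEq n] {A : Matrix n n ℂ}
    (h : A.IsHermitian) :
    A = (h.eigenvectorUnitary : Matrix n n ℂ) * diagonal (fun i => (h.eigenvalues i : ℂ)) *
      (h.eigenvectorUnitary : Matrix n n ℂ)ᴴ := by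
  have := h.spectral_theorem
  rw [Unitary.conjStarAlgAut_apply] at this
  exact this

lemma unit_mul {n : Type*} [Fintype n] [DecidableEq n] {A : Matrix n n ℂ}
    (h : A.IsHermitian) :
    (h.eigenvectorUnitary : Matrix n n ℂ)ᴴ * (h.eigenvectorUnitary : Matrix n n ℂ) = 1 :=
  Unitary.coe_star_mul_self h.eigenvectorUnitary

lemma unit_mul' {n : Type*} [Fintype n] [DecidableEq n] {A : Matrix n n ℂ}
    (h : A.IsHermitian) :
    (h.eigenvectorUnitary : Matrix n n ℂ) * (h.eigenvectorUnitary : Matrix n n ℂ)ᴴ = 1 :=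
  Unitary.coe_mul_star_self h.eigenvectorUnitary

lemma one_sub_posSemidef {n : Type*} [Fintype n] [DecidableEq n] {A : Matrix n n ℂ}
    (hA : IsState A) : (1 - A).PosSemidef := by
  have h := hA.1.1
  have e : 1 - A = (h.eigenvectorUnitary : Matrix n n ℂ) *
      diagonal (fun i => ((1 - h.eigenvalues i : ℝ) : ℂ)) *
      (h.eigenvectorUnitary : Matrix n n ℂ)ᴴ := by
    have : diagonal (fun i => ((1 - h.eigenvalues i : ℝ) : ℂ))
        = 1 - diagonal (fun i => (h.eigenvalues i : ℂ)) := by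
      rw [← diagonal_one, diagonal_sub]; simp
    rw [this, mul_sub, sub_mul, mul_one, unit_mul', ← spectral_mul h]
  rw [e]
  refine (PosSemidef.diagonal ?_).mul_mul_conjTranspose_same _
  intro i
  have ht : ∑ i, h.eigenvalues i = 1 := by
    have := h.trace_eq_sum_eigenvalues
    rw [hA.2] at this
    have h2 : ((∑ i, h.eigenvalues i : ℝ) : ℂ) = 1 := by
      rw [this, Complex.ofReal_sum]; rfl
    exact Complex.ofReal_eq_one.1 h2
  have : h.eigenvalues i ≤ 1 := ht ▸ Finset.single_le_sum
    (f := h.eigenvalues) (fun j _ => hA.1.eigenvalues_nonneg j) (Finset.mem_univ i)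
  simp only [Pi.zero_apply]
  exact_mod_cast sub_nonneg.2 this

lemma ptrace_conj {m l : Type*} [Fintype m] [Fintype l] [DecidableEq m] [DecidableEq l]
    (X Y A : Matrix m m ℂ) (R : Matrix (m × l) (m × l) ℂ)
    (hA : ∀ a a', A a a' = ∑ b, R (a, b) (a', b)) (k k' : m) :
    ∑ b, ((X ⊗ₖ (1 : Matrix l l ℂ)) * R * (Y ⊗ₖ (1 : Matrix l l ℂ))) (k, b) (k', b)
      = (X * A * Y) k k' := by
  simp only [Matrix.mul_apply, Fintype.sum_prod_type, Matrix.kroneckerMap_apply, Matrix.one_apply,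
    hA, mul_ite, ite_mul, mul_one, mul_zero, zero_mul, Finset.sum_ite_eq, Finset.sum_ite_eq',
    Finset.mem_univ, if_true]
  rw [Finset.sum_comm]
  refine Finset.sum_congr rfl fun x _ => ?_
  rw [← Finset.sum_mul, Finset.sum_comm]
  simp_rw [Finset.mul_sum]

lemma entropy_le_of_reduction {m l n : Type*} [Fintype m] [Fintype l] [Fintype n]
    [DecidableEq m] [DecidableEq l] [DecidableEq n] (e : n ≃ m × l)
    {ρ : Matrix n n ℂ} {A : Matrix m m ℂ} (hρ : ρ.PosSemidef) (hA : A.PosSemidef)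
    (hm : ∀ a a', A a a' = ∑ b, ρ (e.symm (a, b)) (e.symm (a', b)))
    (hle : (A ⊗ₖ (1 : Matrix l l ℂ) - ρ.submatrix e.symm e.symm).PosSemidef) :
    vnEntropy A ≤ vnEntropy ρ := by
  rw [vnEntropy, vnEntropy, dif_pos hA.1, dif_pos hρ.1]
  set U : Matrix n n ℂ := (hρ.1.eigenvectorUnitary : Matrix n n ℂ) with hU
  set V : Matrix m m ℂ := (hA.1.eigenvectorUnitary : Matrix m m ℂ) with hV
  set r := hρ.1.eigenvalues with hr
  set a := hA.1.eigenvalues with ha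
  have sρ : ρ = U * diagonal (fun i => (r i : ℂ)) * Uᴴ := spectral_mul hρ.1
  have sA : A = V * diagonal (fun i => (a i : ℂ)) * Vᴴ := spectral_mul hA.1
  have uU : Uᴴ * U = 1 := unit_mul hρ.1
  have uV : Vᴴ * V = 1 := unit_mul hA.1
  have uV' : V * Vᴴ = 1 := unit_mul' hA.1
  set U' : Matrix (m × l) n ℂ := U.submatrix e.symm id with hU'
  set K : Matrix (m × l) (m × l) ℂ := V ⊗ₖ (1 : Matrix l l ℂ) with hK
  have hKs : Kᴴ = Vᴴ ⊗ₖ (1 : Matrix l l ℂ) := by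
    rw [hK, conjTranspose_kronecker, conjTranspose_one]
  have hKK : K * Kᴴ = 1 := by
    rw [hKs, hK, ← mul_kronecker_mul, uV', mul_one, one_kronecker_one]
  have hUU : U'ᴴ * U' = 1 := by
    rw [← uU]
    ext i j
    simp only [hU', mul_apply, conjTranspose_apply, submatrix_apply, id]
    exact e.symm.sum_comp (fun x => star (U x i) * U x j)
  have sρ' : ρ.submatrix e.symm e.symm = U' * diagonal (fun i => (r i : ℂ)) * U'ᴴ := by
    conv_lhs => rw [sρ]
    rfl
  set W : Matrix (m × l) n ℂ := Kᴴ * U' with hWd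
  have hWW : Wᴴ * W = 1 := by
    rw [hWd, conjTranspose_mul, conjTranspose_conjTranspose, Matrix.mul_assoc,
      ← Matrix.mul_assoc K, hKK, Matrix.one_mul, hUU]
  have hWD : W * diagonal (fun i => (r i : ℂ)) * Wᴴ = Kᴴ * ρ.submatrix e.symm e.symm * K := by
    rw [sρ', hWd, conjTranspose_mul, conjTranspose_conjTranspose]
    simp only [Matrix.mul_assoc]
  have hVAV : Vᴴ * A * V = diagonal (fun i => (a i : ℂ)) := by
    conv_lhs => rw [sA]
    calc _ = (Vᴴ * V) * diagonal (fun i => (a i : ℂ)) * (Vᴴ * V) := by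
          simp only [Matrix.mul_assoc]
      _ = _ := by rw [uV, Matrix.one_mul, Matrix.mul_one]
  have hKAK : Kᴴ * (A ⊗ₖ (1 : Matrix l l ℂ)) * K = diagonal (fun q : m × l => (a q.1 : ℂ)) := by
    rw [hKs, hK, ← mul_kronecker_mul, ← mul_kronecker_mul, hVAV, Matrix.one_mul, Matrix.one_mul,
      ← diagonal_one, diagonal_kronecker_diagonal]
    simp
  have hpsd := hle.conjTranspose_mul_mul_same K
  rw [Matrix.mul_sub, Matrix.sub_mul, hKAK, ← hWD] at hpsd
  refine core_ineq W r a (fun j => hρ.eigenvalues_nonneg j) (fun k => hA.eigenvalues_nonneg k)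
    ?_ ?_ ?_
  · intro j
    have := congrFun (congrFun hWW j) j
    rw [mul_apply, one_apply_eq, Fintype.sum_prod_type] at this
    have h' : ((∑ k, ∑ b, Complex.normSq (W (k, b) j) : ℝ) : ℂ) = 1 := by
      rw [← this]
      push_cast
      simp only [Complex.normSq_eq_conj_mul_self, conjTranspose_apply]
      rfl
    exact_mod_cast h'
  · intro z
    have hz := hpsd.dotProduct_mulVec_nonneg z
    rw [sub_mulVec, dotProduct_sub] at hz
    have t1 : star z ⬝ᵥ (diagonal (fun q : m × l => (a q.1 : ℂ)) *ᵥ z)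
        = ((∑ q : m × l, a q.1 * Complex.normSq (z q) : ℝ) : ℂ) := by
      push_cast
      simp only [dotProduct, mulVec_diagonal, Complex.normSq_eq_conj_mul_self, Pi.star_apply]
      refine Finset.sum_congr rfl fun q _ => ?_
      rw [← starRingEnd_apply]; ring
    have t2 : star z ⬝ᵥ ((W * diagonal (fun i => (r i : ℂ)) * Wᴴ) *ᵥ z)
        = ((∑ j, r j * Complex.normSq (∑ q, star (W q j) * z q) : ℝ) : ℂ) := by
      rw [← mulVec_mulVec, ← mulVec_mulVec, dotProduct_mulVec,
        ← conjTranspose_conjTranspose W, ← star_mulVec, conjTranspose_conjTranspose]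
      push_cast
      simp only [dotProduct, mulVec_diagonal, Complex.normSq_eq_conj_mul_self, Pi.star_apply]
      refine Finset.sum_congr rfl fun q _ => ?_
      rw [← starRingEnd_apply]
      simp only [mulVec, dotProduct, conjTranspose_apply, star_star]
      ring
    rw [t1, t2, ← Complex.ofReal_sub] at hz
    exact sub_nonneg.1 (by exact_mod_cast hz)
  · intro k
    have h3 := ptrace_conj Vᴴ V A (ρ.submatrix e.symm e.symm) hm k k
    rw [← hKs, ← hK, ← hWD, hVAV, diagonal_apply_eq] at h3
    have h' : ((∑ j, r j * ∑ b, Complex.normSq (W (k, b) j) : ℝ) : ℂ) = (a k : ℂ) := by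
      rw [← h3]
      push_cast
      simp_rw [Finset.mul_sum]
      rw [Finset.sum_comm]
      refine Finset.sum_congr rfl fun b _ => ?_
      rw [mul_apply]
      refine Finset.sum_congr rfl fun j _ => ?_
      rw [mul_diagonal, conjTranspose_apply, Complex.normSq_eq_conj_mul_self, starRingEnd_apply]
      ring
    exact_mod_cast h'

theorem mutualInfo_separable_le_min {ι : Type*} [Fintype ι]
    (p : ι → ℝ) (hp : ∀ i, 0 ≤ p i) (hp1 : ∑ i, p i = 1)
    (ρi : ι → Matrix α α ℂ) (σi : ι → Matrix β β ℂ)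
    (hρi : ∀ i, IsState (ρi i)) (hσi : ∀ i, IsState (σi i))
    (ρ : Matrix (α × β) (α × β) ℂ)
    (hsep : ρ = ∑ i, p i • ((ρi i) ⊗ₖ (σi i))) :
    mutualInfo ρ ≤ min (vnEntropy (ptraceB ρ)) (vnEntropy (ptraceA ρ)) := by
  have hA : ptraceB ρ = ∑ i, p i • ρi i := by
    ext a a'
    have ht : ∀ i, ∑ b, σi i b b = 1 := fun i => (hσi i).2
    simp only [ptraceB, hsep, Matrix.sum_apply, Matrix.smul_apply, Matrix.kroneckerMap_apply]
    rw [Finset.sum_comm]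
    refine Finset.sum_congr rfl fun i _ => ?_
    rw [← Finset.smul_sum, ← Finset.mul_sum, ht, mul_one]
  have hB : ptraceA ρ = ∑ i, p i • σi i := by
    ext a a'
    have ht : ∀ i, ∑ b, ρi i b b = 1 := fun i => (hρi i).2
    simp only [ptraceA, hsep, Matrix.sum_apply, Matrix.smul_apply, Matrix.kroneckerMap_apply]
    rw [Finset.sum_comm]
    refine Finset.sum_congr rfl fun i _ => ?_
    rw [← Finset.smul_sum, ← Finset.sum_mul, ht, one_mul]
  have hρ : ρ.PosSemidef := by
    rw [hsep]
    exact Matrix.posSemidef_sum _ fun i _ => ((hρi i).1.kronecker (hσi i).1).smul (hp i)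
  have hApos : (ptraceB ρ).PosSemidef := by
    rw [hA]
    exact Matrix.posSemidef_sum _ fun i _ => (hρi i).1.smul (hp i)
  have hBpos : (ptraceA ρ).PosSemidef := by
    rw [hB]
    exact Matrix.posSemidef_sum _ fun i _ => (hσi i).1.smul (hp i)
  have l1 : vnEntropy (ptraceB ρ) ≤ vnEntropy ρ := by
    refine entropy_le_of_reduction (Equiv.refl _) hρ hApos (fun a a' => rfl) ?_
    have : ptraceB ρ ⊗ₖ (1 : Matrix β β ℂ) - ρ.submatrix (Equiv.refl (α × β)).symm
        (Equiv.refl (α × β)).symm = ∑ i, p i • (ρi i ⊗ₖ (1 - σi i)) := by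
      rw [hA]
      ext ⟨a, b⟩ ⟨a', b'⟩
      simp [hsep, Matrix.sum_apply, Finset.sum_mul, mul_sub, mul_assoc]
    rw [this]
    exact Matrix.posSemidef_sum _ fun i _ =>
      ((hρi i).1.kronecker (one_sub_posSemidef (hσi i))).smul (hp i)
  have l2 : vnEntropy (ptraceA ρ) ≤ vnEntropy ρ := by
    refine entropy_le_of_reduction (Equiv.prodComm _ _) hρ hBpos (fun a a' => rfl) ?_
    have : ptraceA ρ ⊗ₖ (1 : Matrix α α ℂ) - ρ.submatrix (Equiv.prodComm α β).symm
        (Equiv.prodComm α β).symm = ∑ i, p i • (σi i ⊗ₖ (1 - ρi i)) := by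
      rw [hB]
      ext ⟨a, b⟩ ⟨a', b'⟩
      simp [hsep, Matrix.sum_apply, Finset.sum_mul, mul_sub, mul_assoc]
      exact Finset.sum_congr rfl fun i _ => by ring
    rw [this]
    exact Matrix.posSemidef_sum _ fun i _ =>
      ((hσi i).1.kronecker (one_sub_posSemidef (hρi i))).smul (hp i)
  rw [mutualInfo]
  exact le_min (by linarith) (by linarith)
end
end

section
/- For finite-dimensional tripartite states ρ_ABC, σ_ABC and p ∈ (0,1), |p·I(A:B|C)_ρ + (1−p)·I(A:B|C)_σ − I(A:B|C)_{pρ+(1−p)σ}| ≤ h₂(p), where I(A:B|C)_ρ = H(ρ_AC) + H(ρ_BC) − H(ρ_ABC) − H(ρ_C). -/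
set_option maxHeartbeats 1000000

open Matrix Real
open scoped ComplexOrder

noncomputable section

/-- The trace norm of a matrix: the sum of its singular values. -/
def traceNorm {n : Type*} [Fintype n] [DecidableEq n] (A : Matrix n n ℂ) : ℝ :=
  ∑ i, Real.sqrt ((Matrix.posSemidef_conjTranspose_mul_self A).1.eigenvalues i)

variable {α β γ : Type*} [Fintype α] [DecidableEq α] [Fintype β] [DecidableEq β]
  [Fintype γ] [DecidableEq γ]

/-- The marginal ρ_AC of a tripartite state. -/
def margAC (ρ : Matrix (α × β × γ) (α × β × γ) ℂ) : Matrix (α × γ) (α × γ) ℂ :=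
  fun x y => ∑ k : β, ρ (x.1, k, x.2) (y.1, k, y.2)

/-- The marginal ρ_BC of a tripartite state. -/
def margBC (ρ : Matrix (α × β × γ) (α × β × γ) ℂ) : Matrix (β × γ) (β × γ) ℂ :=
  fun x y => ∑ k : α, ρ (k, x.1, x.2) (k, y.1, y.2)

/-- The marginal ρ_C of a tripartite state. -/
def margC (ρ : Matrix (α × β × γ) (α × β × γ) ℂ) : Matrix γ γ ℂ :=
  fun i j => ∑ k : α, ∑ l : β, ρ (k, l, i) (k, l, j)

/-- The quantum conditional mutual information
I(A:B|C) = H(ρ_AC) + H(ρ_BC) - H(ρ_ABC) - H(ρ_C). -/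
def qcmi (ρ : Matrix (α × β × γ) (α × β × γ) ℂ) : ℝ :=
  vnEntropy (margAC ρ) + vnEntropy (margBC ρ) - vnEntropy ρ - vnEntropy (margC ρ)


lemma scal_int (l m : ℝ) (hl : 0 ≤ l) (hm : 0 < m) :
    IntervalIntegrable (fun s => (1-s)*((l-m)^2/(s*l+(1-s)*m))) MeasureTheory.volume 0 1 ∧
    ∫ s in (0:ℝ)..1, (1-s)*((l-m)^2/(s*l+(1-s)*m)) = l * log l - l * log m - l + m := by
  have hcont : ContinuousOn (fun s : ℝ => l * log (s*l+(1-s)*m) - s*(l-m)) (Set.Icc 0 1) := by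
    rcases hl.eq_or_lt with h | h
    · subst h; simp only [zero_mul]; fun_prop
    · have : ∀ s ∈ Set.Icc (0:ℝ) 1, s*l+(1-s)*m ≠ 0 := by
        intro s hs
        have h1 := hs.1
        have h2 : 0 ≤ 1 - s := by linarith [hs.2]
        rcases h1.eq_or_lt with h3 | h3
        · subst h3; simp; exact hm.ne'
        · positivity
      fun_prop (disch := assumption)
  have hpos : ∀ s ∈ Set.Ioo (0:ℝ) 1, 0 < s*l+(1-s)*m := by
    intro s hs
    have h1 := hs.1
    have h2 : 0 < 1 - s := by linarith [hs.2]
    positivity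
  have hder : ∀ s ∈ Set.Ioo (0:ℝ) 1, HasDerivAt (fun s : ℝ => l * log (s*l+(1-s)*m) - s*(l-m))
      ((1-s)*((l-m)^2/(s*l+(1-s)*m))) s := by
    intro s hs
    have hp := hpos s hs
    have h1 : HasDerivAt (fun s : ℝ => s*l+(1-s)*m) (l - m) s := by
      have := ((hasDerivAt_id s).mul_const l).add (((hasDerivAt_id s).const_sub 1).mul_const m)
      exact this.congr_deriv (by ring)
    have h2 := ((h1.log hp.ne').const_mul l).sub ((hasDerivAt_id s).mul_const (l-m))
    refine h2.congr_deriv ?_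
    obtain ⟨k, hk⟩ : ∃ k, k = s*l+(1-s)*m := ⟨_, rfl⟩
    rw [← hk] at hp ⊢
    field_simp
    rw [hk]
    ring
  have hint : IntervalIntegrable (fun s => (1-s)*((l-m)^2/(s*l+(1-s)*m))) MeasureTheory.volume 0 1 := by
    rw [intervalIntegrable_iff_integrableOn_Ioc_of_le zero_le_one]
    refine intervalIntegral.integrableOn_deriv_of_nonneg hcont hder ?_
    intro s hs
    have := hpos s hs
    have h2 : 0 < 1 - s := by linarith [hs.2]
    positivity
  refine ⟨hint, ?_⟩
  rw [intervalIntegral.integral_eq_sub_of_hasDerivAt_of_le zero_le_one hcont hder hint]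
  simp
  ring

/-- A unitary diagonalisation of `A`. -/
def Dec {n : Type*} [Fintype n] [DecidableEq n] (A U : Matrix n n ℂ) (l : n → ℝ) : Prop :=
  U * Uᴴ = 1 ∧ Uᴴ * U = 1 ∧ A = U * diagonal (fun i => (l i : ℂ)) * Uᴴ

/-- Relative entropy in terms of diagonalisations. -/
def DD {n : Type*} [Fintype n] [DecidableEq n] (U V : Matrix n n ℂ) (l m : n → ℝ) : ℝ :=
  ∑ i, ∑ j, Complex.normSq ((Uᴴ * V) i j) * (l i * log (l i) - l i * log (m j) - l i + m j)

/-- The quadratic quantity in the integral representation. -/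
def QQ {n : Type*} [Fintype n] [DecidableEq n] (U V : Matrix n n ℂ) (l m : n → ℝ) (s : ℝ) : ℝ :=
  ∑ i, ∑ j, Complex.normSq ((Uᴴ * V) i j) * ((l i - m j)^2/(s * l i + (1-s)*m j))

/-- The affine functional. -/
def FF {n : Type*} [Fintype n] [DecidableEq n] (A B Y : Matrix n n ℂ) (s : ℝ) : ℝ :=
  (2 * trace (Yᴴ * (A - B)) - s * trace (Yᴴ * A * Y) - (1 - s) * trace (Y * B * Yᴴ)).re

section
variable {n : Type*} [Fintype n] [DecidableEq n]

lemma DD_int (U V : Matrix n n ℂ) (l m : n → ℝ) (hl : ∀ i, 0 ≤ l i) (hm : ∀ i, 0 < m i) :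
    IntervalIntegrable (fun s => (1-s) * QQ U V l m s) MeasureTheory.volume 0 1 ∧
    ∫ s in (0:ℝ)..1, (1-s) * QQ U V l m s = DD U V l m := by
  have e : (fun s => (1-s) * QQ U V l m s) = fun s => ∑ i, ∑ j, Complex.normSq ((Uᴴ * V) i j) *
      ((1-s)*((l i - m j)^2/(s * l i + (1-s)*m j))) := by
    ext s
    simp only [QQ, Finset.mul_sum]
    refine Finset.sum_congr rfl fun i _ => Finset.sum_congr rfl fun j _ => ?_
    ring
  have h1 : ∀ i j, IntervalIntegrable (fun s => Complex.normSq ((Uᴴ * V) i j) *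
      ((1-s)*((l i - m j)^2/(s * l i + (1-s)*m j)))) MeasureTheory.volume 0 1 :=
    fun i j => (scal_int (l i) (m j) (hl i) (hm j)).1.const_mul _
  have h2 : ∀ i, IntervalIntegrable (fun s => ∑ j, Complex.normSq ((Uᴴ * V) i j) *
      ((1-s)*((l i - m j)^2/(s * l i + (1-s)*m j)))) MeasureTheory.volume 0 1 := by
    intro i
    have := IntervalIntegrable.sum Finset.univ (fun j _ => h1 i j)
    rw [Finset.sum_fn] at this
    exact this
  rw [e]
  constructor
  · have := IntervalIntegrable.sum Finset.univ (fun j _ => h2 j)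
    rw [Finset.sum_fn] at this
    exact this
  · rw [intervalIntegral.integral_finsetSum (fun i _ => h2 i)]
    unfold DD
    refine Finset.sum_congr rfl fun i _ => ?_
    rw [intervalIntegral.integral_finsetSum (fun j _ => h1 i j)]
    refine Finset.sum_congr rfl fun j _ => ?_
    rw [intervalIntegral.integral_const_mul, (scal_int (l i) (m j) (hl i) (hm j)).2]

lemma FF_eq {A B U V : Matrix n n ℂ} {l m : n → ℝ} (hA : Dec A U l) (hB : Dec B V m)
    (Z : Matrix n n ℂ) (s : ℝ) :
    FF A B (U * Z * Vᴴ) s = ∑ i, ∑ j, (2 * (star (Z i j) * (Uᴴ * V) i j).re * (l i - m j)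
      - (s * l i + (1-s) * m j) * Complex.normSq (Z i j)) := by
  obtain ⟨hU1, hU2, rfl⟩ := hA
  obtain ⟨hV1, hV2, rfl⟩ := hB
  set L := diagonal (fun i => (l i : ℂ)) with hL
  set M := diagonal (fun i => (m i : ℂ)) with hM
  have e1 : trace ((U * Z * Vᴴ)ᴴ * (U * L * Uᴴ - V * M * Vᴴ))
      = trace (Zᴴ * (L * (Uᴴ * V) - (Uᴴ * V) * M)) := by
    have : (U * Z * Vᴴ)ᴴ * (U * L * Uᴴ - V * M * Vᴴ)
      = V * (Zᴴ * (Uᴴ * U) * L * Uᴴ - Zᴴ * Uᴴ * V * M * Vᴴ) := by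
      simp only [conjTranspose_mul, conjTranspose_conjTranspose, mul_sub, Matrix.mul_assoc]
    rw [this, trace_mul_comm, hU2]
    have : (Zᴴ * 1 * L * Uᴴ - Zᴴ * Uᴴ * V * M * Vᴴ) * V = 
      Zᴴ * L * Uᴴ * V - Zᴴ * Uᴴ * V * M * (Vᴴ * V) := by
      simp only [sub_mul, Matrix.mul_assoc, Matrix.one_mul]
    rw [this, hV2]
    simp only [mul_sub, Matrix.mul_assoc, Matrix.mul_one]
  have e2 : trace ((U * Z * Vᴴ)ᴴ * (U * L * Uᴴ) * (U * Z * Vᴴ)) = trace (Zᴴ * (L * Z)) := by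
    have : (U * Z * Vᴴ)ᴴ * (U * L * Uᴴ) * (U * Z * Vᴴ)
      = V * (Zᴴ * (Uᴴ * U) * L * (Uᴴ * U) * Z * Vᴴ) := by
      simp only [conjTranspose_mul, conjTranspose_conjTranspose, Matrix.mul_assoc]
    rw [this, trace_mul_comm, hU2]
    simp only [Matrix.mul_assoc, hV2, Matrix.mul_one, Matrix.one_mul]
  have e3 : trace ((U * Z * Vᴴ) * (V * M * Vᴴ) * (U * Z * Vᴴ)ᴴ) = trace (Zᴴ * (Z * M)) := by
    have : (U * Z * Vᴴ) * (V * M * Vᴴ) * (U * Z * Vᴴ)ᴴ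
      = U * (Z * (Vᴴ * V) * M * (Vᴴ * V) * Zᴴ * Uᴴ) := by
      simp only [conjTranspose_mul, conjTranspose_conjTranspose, Matrix.mul_assoc]
    rw [this, trace_mul_comm, hV2]
    simp only [Matrix.mul_assoc, hU2, Matrix.mul_one, Matrix.one_mul]
    rw [← Matrix.mul_assoc, trace_mul_comm]
  unfold FF
  rw [e1, e2, e3]
  set W := Uᴴ * V
  have t : ∀ X : Matrix n n ℂ, trace (Zᴴ * X) = ∑ i, ∑ j, star (Z i j) * X i j := by
    intro X
    simp only [trace, diag, mul_apply, conjTranspose_apply]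
    rw [Finset.sum_comm]
  rw [t, t, t]
  simp only [Finset.mul_sum, ← Finset.sum_sub_distrib, Complex.re_sum]
  refine Finset.sum_congr rfl fun i _ => Finset.sum_congr rfl fun j _ => ?_
  simp only [hL, hM, Matrix.sub_apply, diagonal_mul, mul_diagonal, Complex.normSq_apply]
  simp [Complex.mul_re, Complex.mul_im]
  ring

lemma Dec.FF_le {A B U V : Matrix n n ℂ} {l m : n → ℝ} (hA : Dec A U l) (hB : Dec B V m)
    (hl : ∀ i, 0 ≤ l i) (hm : ∀ i, 0 < m i) (Y : Matrix n n ℂ) (s : ℝ) (h0 : 0 < s) (h1 : s < 1) :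
    FF A B Y s ≤ QQ U V l m s := by
  have : Y = U * (Uᴴ * Y * V) * Vᴴ := by
    have : U * (Uᴴ * Y * V) * Vᴴ = (U * Uᴴ) * Y * (V * Vᴴ) := by simp only [Matrix.mul_assoc]
    rw [this, hA.1, hB.1]; simp
  rw [this, FF_eq hA hB]
  generalize Uᴴ * Y * V = Z
  unfold QQ
  refine Finset.sum_le_sum fun i _ => Finset.sum_le_sum fun j _ => ?_
  have hpos : 0 < s * l i + (1-s) * m j := by
    have := hl i
    have := hm j
    have : 0 < 1 - s := by linarith
    positivity
  set k := s * l i + (1-s) * m j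
  rw [← mul_div_assoc, le_div_iff₀ hpos]
  generalize (Uᴴ * V) i j = w
  generalize Z i j = z
  simp only [Complex.normSq_apply, Complex.mul_re, Complex.star_def, Complex.conj_re, Complex.conj_im]
  nlinarith [sq_nonneg (w.re * (l i - m j) - k * z.re), sq_nonneg (w.im * (l i - m j) - k * z.im)]

lemma Dec.exists_FF {A B U V : Matrix n n ℂ} {l m : n → ℝ} (hA : Dec A U l) (hB : Dec B V m)
    (hl : ∀ i, 0 ≤ l i) (hm : ∀ i, 0 < m i) (s : ℝ) (h0 : 0 < s) (h1 : s < 1) :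
    ∃ Y, FF A B Y s = QQ U V l m s := by
  refine ⟨U * (Matrix.of fun i j => (((l i - m j) / (s * l i + (1-s) * m j) : ℝ) : ℂ) * (Uᴴ * V) i j) * Vᴴ, ?_⟩
  rw [FF_eq hA hB]
  unfold QQ
  refine Finset.sum_congr rfl fun i _ => Finset.sum_congr rfl fun j _ => ?_
  have hpos : 0 < s * l i + (1-s) * m j := by
    have := hl i
    have := hm j
    have : 0 < 1 - s := by linarith
    positivity
  simp only [Matrix.of_apply]
  generalize (Uᴴ * V) i j = w
  generalize s * l i + (1-s) * m j = k at hpos ⊢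
  rw [Complex.normSq_mul, Complex.normSq_ofReal, star_mul', mul_assoc (star _), 
    show star w = (starRingEnd ℂ) w from rfl, ← Complex.normSq_eq_conj_mul_self, Complex.star_def, Complex.conj_ofReal,
    ← Complex.ofReal_mul, Complex.ofReal_re]
  field_simp
  ring

theorem joint_conv {A B U V : Matrix n n ℂ} {l m : n → ℝ} (hA : Dec A U l) (hB : Dec B V m)
    (hl : ∀ i, 0 ≤ l i) (hm : ∀ i, 0 < m i)
    {A₁ B₁ U₁ V₁ : Matrix n n ℂ} {l₁ m₁ : n → ℝ} (hA₁ : Dec A₁ U₁ l₁) (hB₁ : Dec B₁ V₁ m₁)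
    (hl₁ : ∀ i, 0 ≤ l₁ i) (hm₁ : ∀ i, 0 < m₁ i)
    {A₂ B₂ U₂ V₂ : Matrix n n ℂ} {l₂ m₂ : n → ℝ} (hA₂ : Dec A₂ U₂ l₂) (hB₂ : Dec B₂ V₂ m₂)
    (hl₂ : ∀ i, 0 ≤ l₂ i) (hm₂ : ∀ i, 0 < m₂ i)
    (p q : ℝ) (hp : 0 ≤ p) (hq : 0 ≤ q) (eA : A = p • A₁ + q • A₂) (eB : B = p • B₁ + q • B₂) :
    DD U V l m ≤ p * DD U₁ V₁ l₁ m₁ + q * DD U₂ V₂ l₂ m₂ := by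
  obtain ⟨i0, e0⟩ := DD_int U V l m hl hm
  obtain ⟨i1, e1⟩ := DD_int U₁ V₁ l₁ m₁ hl₁ hm₁
  obtain ⟨i2, e2⟩ := DD_int U₂ V₂ l₂ m₂ hl₂ hm₂
  rw [← e0, ← e1, ← e2, ← intervalIntegral.integral_const_mul, ← intervalIntegral.integral_const_mul,
    ← intervalIntegral.integral_add (i1.const_mul p) (i2.const_mul q)]
  refine intervalIntegral.integral_mono_on_of_le_Ioo zero_le_one i0
    ((i1.const_mul p).add (i2.const_mul q)) ?_
  intro s hs
  obtain ⟨Y, hY⟩ := hA.exists_FF hB hl hm s hs.1 hs.2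
  have h1 := hA₁.FF_le hB₁ hl₁ hm₁ Y s hs.1 hs.2
  have h2 := hA₂.FF_le hB₂ hl₂ hm₂ Y s hs.1 hs.2
  have key : FF A B Y s = p * FF A₁ B₁ Y s + q * FF A₂ B₂ Y s := by
    subst eA eB
    simp only [FF, mul_sub, mul_add, add_mul, Matrix.mul_smul, Matrix.smul_mul, trace_add, trace_sub,
      trace_smul, Complex.sub_re, Complex.add_re, Complex.mul_re, Complex.smul_re, Complex.smul_im,
      Complex.add_im, Complex.sub_im, Complex.ofReal_re, Complex.ofReal_im, smul_eq_mul, Complex.one_re,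
      Complex.one_im, Complex.re_ofNat, Complex.im_ofNat, one_mul]
    ring
  have h3 : 0 ≤ 1 - s := by linarith [hs.2]
  have : QQ U V l m s ≤ p * QQ U₁ V₁ l₁ m₁ s + q * QQ U₂ V₂ l₂ m₂ s := by
    rw [← hY, key]
    gcongr
  calc _ ≤ (1-s) * (p * QQ U₁ V₁ l₁ m₁ s + q * QQ U₂ V₂ l₂ m₂ s) := by gcongr
    _ = _ := by ring

lemma row_sum {W : Matrix n n ℂ} (h : W * Wᴴ = 1) (i : n) : ∑ j, Complex.normSq (W i j) = 1 := by
  have := congrFun (congrFun h i) i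
  simp only [mul_apply, conjTranspose_apply, one_apply_eq] at this
  have h2 := congrArg Complex.re this
  simp only [Complex.re_sum, Complex.one_re] at h2
  rw [← h2]
  refine Finset.sum_congr rfl fun j _ => ?_
  simp [Complex.normSq_apply]

lemma col_sum {W : Matrix n n ℂ} (h : Wᴴ * W = 1) (j : n) : ∑ i, Complex.normSq (W i j) = 1 := by
  have := row_sum (W := Wᴴ) (by simpa using h) j
  simpa using this

lemma Dec.DD_eq {A B U V : Matrix n n ℂ} {l m : n → ℝ} (hA : Dec A U l) (hB : Dec B V m) :
    DD U V l m = - ∑ i, negMulLog (l i) - ∑ j, ((Vᴴ * A * V) j j).re * log (m j)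
      - ∑ i, l i + ∑ i, m i := by
  have hr : (Uᴴ * V) * (Uᴴ * V)ᴴ = 1 := by
    have : (Uᴴ * V) * (Uᴴ * V)ᴴ = Uᴴ * (V * Vᴴ) * U := by
      simp [conjTranspose_mul, Matrix.mul_assoc]
    rw [this, hB.1]; simp [hA.2.1]
  have hc : (Uᴴ * V)ᴴ * (Uᴴ * V) = 1 := by
    have : (Uᴴ * V)ᴴ * (Uᴴ * V) = Vᴴ * (U * Uᴴ) * V := by
      simp [conjTranspose_mul, Matrix.mul_assoc]
    rw [this, hA.1]; simp [hB.2.1]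
  have hm : ∀ j, ((Vᴴ * A * V) j j).re = ∑ i, Complex.normSq ((Uᴴ * V) i j) * l i := by
    intro j
    have : Vᴴ * A * V = (Uᴴ * V)ᴴ * (diagonal (fun i => (l i : ℂ)) * (Uᴴ * V)) := by
      rw [hA.2.2]; simp [conjTranspose_mul, Matrix.mul_assoc]
    rw [this, mul_apply, Complex.re_sum]
    refine Finset.sum_congr rfl fun i _ => ?_
    simp only [conjTranspose_apply, diagonal_mul, Complex.normSq_apply]
    simp
    ring
  simp only [hm]
  unfold DD
  generalize Uᴴ * V = W at *
  have t1 : ∑ i, ∑ j, Complex.normSq (W i j) * (l i * log (l i) - l i) = 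
      - ∑ i, negMulLog (l i) - ∑ i, l i := by
    simp only [← Finset.sum_mul, row_sum hr, one_mul, Finset.sum_sub_distrib, negMulLog, neg_mul, 
      Finset.sum_neg_distrib, neg_neg]
  have t2 : ∑ i, ∑ j, Complex.normSq (W i j) * m j = ∑ i, m i := by
    rw [Finset.sum_comm]
    simp only [← Finset.sum_mul, col_sum hc, one_mul]
  have t3 : ∑ i, ∑ j, Complex.normSq (W i j) * l i * log (m j) = 
     ∑ j, (∑ i, Complex.normSq (W i j) * l i) * log (m j) := by
    rw [Finset.sum_comm]; simp only [Finset.sum_mul]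
  rw [← t3, ← t2]
  have : - ∑ i, negMulLog (l i) = (∑ i, ∑ j, Complex.normSq (W i j) * (l i * log (l i) - l i)) + ∑ i, l i := by
    rw [t1]; ring
  rw [this, add_sub_right_comm, add_sub_cancel_right]
  simp only [← Finset.sum_sub_distrib, ← Finset.sum_add_distrib]
  refine Finset.sum_congr rfl fun i _ => Finset.sum_congr rfl fun j _ => ?_
  ring
end

section
variable {n : Type*} [Fintype n] [DecidableEq n]

lemma Dec.add_eps {A U : Matrix n n ℂ} {l : n → ℝ} (h : Dec A U l) (e : ℝ) :
    Dec (A + e • (1 : Matrix n n ℂ)) U (fun i => l i + e) := by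
  refine ⟨h.1, h.2.1, ?_⟩
  have : diagonal (fun i => ((l i + e : ℝ) : ℂ)) =
      diagonal (fun i => (l i : ℂ)) + e • (1 : Matrix n n ℂ) := by
    ext i j
    by_cases hij : i = j
    · subst hij; simp
    · simp [hij]
  rw [this, mul_add, add_mul, ← h.2.2, Matrix.mul_smul, Matrix.smul_mul, Matrix.mul_one, h.1]

lemma Dec.rsmul {A U : Matrix n n ℂ} {l : n → ℝ} (h : Dec A U l) (e : ℝ) :
    Dec (e • A) U (fun i => e * l i) := by
  refine ⟨h.1, h.2.1, ?_⟩
  have : diagonal (fun i => ((e * l i : ℝ) : ℂ)) = e • diagonal (fun i => (l i : ℂ)) := by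
    ext i j
    by_cases hij : i = j
    · subst hij; simp
    · simp [hij]
  rw [this, Matrix.mul_smul, Matrix.smul_mul, ← h.2.2]

lemma Dec.zero : Dec (0 : Matrix n n ℂ) 1 (fun _ => 0) := by
  refine ⟨by simp, by simp, ?_⟩
  simp

lemma Dec.one : Dec (1 : Matrix n n ℂ) 1 (fun _ => 1) := by
  refine ⟨by simp, by simp, ?_⟩
  simp

lemma Dec.diag {A U : Matrix n n ℂ} {l : n → ℝ} (h : Dec A U l) (j : n) :
    ((Uᴴ * A * U) j j).re = l j := by
  have : Uᴴ * A * U = (Uᴴ * U) * diagonal (fun i => (l i : ℂ)) * (Uᴴ * U) := by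
    rw [h.2.2]; simp only [Matrix.mul_assoc]
  rw [this, h.2.1]; simp

lemma Dec.tr {A U : Matrix n n ℂ} {l : n → ℝ} (h : Dec A U l) : (trace A).re = ∑ i, l i := by
  rw [h.2.2, trace_mul_comm, ← Matrix.mul_assoc, h.2.1]
  simp [trace]

lemma Dec.of_herm {A : Matrix n n ℂ} (h : A.IsHermitian) :
    Dec A (h.eigenvectorUnitary : Matrix n n ℂ) h.eigenvalues := by
  refine ⟨?_, ?_, ?_⟩
  · exact Unitary.mul_star_self_of_mem h.eigenvectorUnitary.2
  · exact Unitary.star_mul_self_of_mem h.eigenvectorUnitary.2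
  · have := h.spectral_theorem
    conv_lhs => rw [this]
    rw [Unitary.conjStarAlgAut_apply]
    rfl

lemma lim_le {f g : ℝ → ℝ} (hf : Continuous f) (hg : Continuous g)
    (h : ∀ e, 0 < e → f e ≤ g e) : f 0 ≤ g 0 := by
  refine le_of_tendsto_of_tendsto (b := nhdsWithin 0 (Set.Ioi 0))
    ((hf.tendsto 0).mono_left nhdsWithin_le_nhds)
    ((hg.tendsto 0).mono_left nhdsWithin_le_nhds) ?_
  filter_upwards [self_mem_nhdsWithin] with e he using h e he

lemma ent_cont (l : n → ℝ) (c : ℝ) : Continuous (fun e : ℝ => ∑ i, negMulLog (l i + c * e)) := by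
  have := continuous_negMulLog
  fun_prop

theorem ent_concave {A U : Matrix n n ℂ} {l : n → ℝ} (hA : Dec A U l) (hl : ∀ i, 0 ≤ l i)
    {A₁ U₁ : Matrix n n ℂ} {l₁ : n → ℝ} (hA₁ : Dec A₁ U₁ l₁) (hl₁ : ∀ i, 0 ≤ l₁ i)
    {A₂ U₂ : Matrix n n ℂ} {l₂ : n → ℝ} (hA₂ : Dec A₂ U₂ l₂) (hl₂ : ∀ i, 0 ≤ l₂ i)
    (p q : ℝ) (hp : 0 ≤ p) (hq : 0 ≤ q) (hpq : p + q = 1) (eA : A = p • A₁ + q • A₂) :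
    p * ∑ i, negMulLog (l₁ i) + q * ∑ i, negMulLog (l₂ i) ≤ ∑ i, negMulLog (l i) := by
  have h := joint_conv hA Dec.one hl (fun _ => one_pos) hA₁ Dec.one hl₁ (fun _ => one_pos)
    hA₂ Dec.one hl₂ (fun _ => one_pos) p q hp hq eA (by rw [← add_smul, hpq, one_smul])
  rw [hA.DD_eq Dec.one, hA₁.DD_eq Dec.one, hA₂.DD_eq Dec.one, ← hA.tr, ← hA₁.tr, ← hA₂.tr, eA] at h
  simp only [trace_add, trace_smul, Complex.add_re, Complex.smul_re, smul_eq_mul, Real.log_one, mul_zero,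
    Finset.sum_const_zero] at h
  have hq' : q = 1 - p := by linarith
  subst hq'
  linarith

theorem ent_subadd_pos {A B U V W : Matrix n n ℂ} {l m k : n → ℝ} (hA : Dec A U l) (hB : Dec B V m)
    (hC : Dec (A + B) W k) (hl : ∀ i, 0 < l i) (hm : ∀ i, 0 < m i) (hk : ∀ i, 0 < k i) :
    ∑ i, negMulLog (k i) ≤ ∑ i, negMulLog (l i) + ∑ i, negMulLog (m i) := by
  have h1 := joint_conv hA hC (fun i => (hl i).le) hk hA hA (fun i => (hl i).le) hl
    Dec.zero hB (fun _ => le_rfl) hm 1 1 zero_le_one zero_le_one (by simp) (by simp)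
  have h2 := joint_conv hB hC (fun i => (hm i).le) hk hB hB (fun i => (hm i).le) hm
    Dec.zero hA (fun _ => le_rfl) hl 1 1 zero_le_one zero_le_one (by simp) (by simp [add_comm])
  rw [hA.DD_eq hC, hA.DD_eq hA, Dec.zero.DD_eq hB] at h1
  rw [hB.DD_eq hC, hB.DD_eq hB, Dec.zero.DD_eq hA] at h2
  have ht : ∑ i, k i = ∑ i, l i + ∑ i, m i := by
    rw [← hA.tr, ← hB.tr, ← hC.tr]; simp
  have hS : ∀ f : n → ℝ, ∑ j, f j * log (f j) = - ∑ j, negMulLog (f j) := by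
    intro f; simp [negMulLog]
  have hsum : ∑ j, ((Wᴴ * A * W) j j).re * log (k j) + ∑ j, ((Wᴴ * B * W) j j).re * log (k j)
      = - ∑ j, negMulLog (k j) := by
    rw [← hS, ← Finset.sum_add_distrib]
    refine Finset.sum_congr rfl fun j _ => ?_
    have := hC.diag j
    rw [mul_add, add_mul, Matrix.add_apply, Complex.add_re] at this
    rw [← add_mul, this]
  simp only [hA.diag, hB.diag, hS] at h1 h2
  simp at h1 h2
  linarith

theorem ent_subadd {A B U V W : Matrix n n ℂ} {l m k : n → ℝ} (hA : Dec A U l) (hB : Dec B V m)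
    (hC : Dec (A + B) W k) (hl : ∀ i, 0 ≤ l i) (hm : ∀ i, 0 ≤ m i) (hk : ∀ i, 0 ≤ k i) :
    ∑ i, negMulLog (k i) ≤ ∑ i, negMulLog (l i) + ∑ i, negMulLog (m i) := by
  have := lim_le (ent_cont k 2) ((ent_cont l 1).add (ent_cont m 1)) ?_
  · simpa using this
  intro e he
  have hC' := hC.add_eps (2 * e)
  have : A + B + (2 * e) • (1 : Matrix n n ℂ) = (A + e • 1) + (B + e • 1) := by
    rw [two_mul, add_smul]; abel
  rw [this] at hC'
  simp only [one_mul]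
  exact ent_subadd_pos (hA.add_eps e) (hB.add_eps e) hC' (fun i => by linarith [hl i])
    (fun i => by linarith [hm i]) (fun i => by linarith [hk i])

theorem ent_upper {A U : Matrix n n ℂ} {l : n → ℝ} (hA : Dec A U l) (hl : ∀ i, 0 ≤ l i)
    {A₁ U₁ : Matrix n n ℂ} {l₁ : n → ℝ} (hA₁ : Dec A₁ U₁ l₁) (hl₁ : ∀ i, 0 ≤ l₁ i)
    {A₂ U₂ : Matrix n n ℂ} {l₂ : n → ℝ} (hA₂ : Dec A₂ U₂ l₂) (hl₂ : ∀ i, 0 ≤ l₂ i)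
    (t₁ : trace A₁ = 1) (t₂ : trace A₂ = 1)
    (p : ℝ) (hp : 0 ≤ p) (hq : 0 ≤ 1 - p) (eA : A = p • A₁ + (1 - p) • A₂) :
    ∑ i, negMulLog (l i) ≤
      p * ∑ i, negMulLog (l₁ i) + (1 - p) * ∑ i, negMulLog (l₂ i) + binEntropy p := by
  have h := ent_subadd (hA₁.rsmul p) (hA₂.rsmul (1-p)) (eA ▸ hA) (fun i => mul_nonneg hp (hl₁ i))
    (fun i => mul_nonneg hq (hl₂ i)) hl
  simp only [negMulLog_mul, Finset.sum_add_distrib, ← Finset.sum_mul, ← Finset.mul_sum, ← hA₁.tr,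
    ← hA₂.tr, t₁, t₂, Complex.one_re] at h
  rw [binEntropy_eq_negMulLog_add_negMulLog_one_sub]
  linarith
end

section
variable {a b : Type*} [Fintype a] [DecidableEq a] [Fintype b] [DecidableEq b]

/-- Partial trace over the first factor. -/
def ptr (A : Matrix (a × b) (a × b) ℂ) : Matrix b b ℂ :=
  fun i j => ∑ k : a, A (k, i) (k, j)

open Kronecker in
lemma Dec.kron {B V : Matrix b b ℂ} {m : b → ℝ} (h : Dec B V m) :
    Dec ((1 : Matrix a a ℂ) ⊗ₖ B) ((1 : Matrix a a ℂ) ⊗ₖ V) (fun x => m x.2) := by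
  refine ⟨?_, ?_, ?_⟩
  · rw [conjTranspose_kronecker, ← mul_kronecker_mul, h.1]; simp
  · rw [conjTranspose_kronecker, ← mul_kronecker_mul, h.2.1]; simp
  · have : diagonal (fun x : a × b => (m x.2 : ℂ)) = (1 : Matrix a a ℂ) ⊗ₖ diagonal (fun i => (m i : ℂ)) := by
      rw [← diagonal_one, diagonal_kronecker_diagonal]; simp
    rw [this, conjTranspose_kronecker, ← mul_kronecker_mul, ← mul_kronecker_mul, ← h.2.2]; simp

open Kronecker in
lemma kron_diag (A : Matrix (a × b) (a × b) ℂ) (V : Matrix b b ℂ) (j : b) :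
    ∑ k : a, ((((1 : Matrix a a ℂ) ⊗ₖ V)ᴴ * A * ((1 : Matrix a a ℂ) ⊗ₖ V)) (k, j) (k, j)) =
      (Vᴴ * ptr A * V) j j := by
  have h : ∀ k : a, ((((1 : Matrix a a ℂ) ⊗ₖ V)ᴴ * A * ((1 : Matrix a a ℂ) ⊗ₖ V)) (k, j) (k, j)) =
      ∑ y, ∑ x, star (V x j) * A (k, x) (k, y) * V y j := by
    intro k
    simp only [mul_apply, Fintype.sum_prod_type, conjTranspose_apply, kroneckerMap_apply, one_apply,
      ite_mul, mul_ite, zero_mul, mul_zero, one_mul, star_zero, star_one, apply_ite star]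
    simp [Finset.sum_ite_eq, Finset.sum_mul, Finset.sum_ite_irrel]
  simp only [h, mul_apply, ptr, conjTranspose_apply, Finset.mul_sum, Finset.sum_mul]
  rw [Finset.sum_comm]
  refine Finset.sum_congr rfl fun y _ => ?_
  rw [Finset.sum_comm]

lemma Dec.DD_cond {A U : Matrix (a × b) (a × b) ℂ} {l : a × b → ℝ} (hA : Dec A U l)
    {V : Matrix b b ℂ} {m : b → ℝ} (hB : Dec (ptr A) V m) :
    DD U (kroneckerMap (· * ·) (1 : Matrix a a ℂ) V) l (fun x => m x.2) =
      - ∑ i, negMulLog (l i) + ∑ i, negMulLog (m i) - (trace A).re +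
        Fintype.card a * (trace (ptr A)).re := by
  rw [hA.DD_eq hB.kron, hA.tr, hB.tr]
  have h1 : ∑ x : a × b, m x.2 = Fintype.card a * ∑ i, m i := by
    rw [Fintype.sum_prod_type]; simp
  have h2 : ∑ j : a × b, (((kroneckerMap (· * ·) (1 : Matrix a a ℂ) V)ᴴ * A * 
      (kroneckerMap (· * ·) (1 : Matrix a a ℂ) V)) j j).re * log (m j.2) = - ∑ i, negMulLog (m i) := by
    rw [Fintype.sum_prod_type, Finset.sum_comm, ← Finset.sum_neg_distrib]
    refine Finset.sum_congr rfl fun j _ => ?_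
    dsimp only
    rw [← Finset.sum_mul, ← Complex.re_sum, kron_diag, hB.diag]
    simp [negMulLog]
  rw [h1, h2]
  ring

lemma ptr_lin (A₁ A₂ : Matrix (a × b) (a × b) ℂ) (p q : ℝ) :
    ptr (p • A₁ + q • A₂) = p • ptr A₁ + q • ptr A₂ := by
  ext i j
  simp [ptr, Finset.sum_add_distrib, Finset.mul_sum]

lemma ptr_eps (A : Matrix (a × b) (a × b) ℂ) (e : ℝ) :
    ptr (A + e • (1 : Matrix (a × b) (a × b) ℂ)) = ptr A + (Fintype.card a * e) • (1 : Matrix b b ℂ) := by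
  ext i j
  by_cases h : i = j
  · subst h; simp [ptr, Finset.sum_add_distrib]
  · simp [ptr, Finset.sum_add_distrib, h, one_apply]

lemma ptr_psd {A : Matrix (a × b) (a × b) ℂ} (hA : A.PosSemidef) : (ptr A).PosSemidef := by
  have : ptr A = ∑ k : a, A.submatrix (fun i => (k, i)) (fun i => (k, i)) := by
    ext i j; simp [ptr, Matrix.sum_apply]
  rw [this]
  exact posSemidef_sum _ fun k _ => hA.submatrix _

theorem cond_concave_pos {A U : Matrix (a × b) (a × b) ℂ} {l : a × b → ℝ} (hA : Dec A U l)
    (hl : ∀ i, 0 ≤ l i) {V : Matrix b b ℂ} {m : b → ℝ} (hB : Dec (ptr A) V m) (hm : ∀ i, 0 < m i)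
    {A₁ U₁ : Matrix (a × b) (a × b) ℂ} {l₁ : a × b → ℝ} (hA₁ : Dec A₁ U₁ l₁)
    (hl₁ : ∀ i, 0 ≤ l₁ i) {V₁ : Matrix b b ℂ} {m₁ : b → ℝ} (hB₁ : Dec (ptr A₁) V₁ m₁) (hm₁ : ∀ i, 0 < m₁ i)
    {A₂ U₂ : Matrix (a × b) (a × b) ℂ} {l₂ : a × b → ℝ} (hA₂ : Dec A₂ U₂ l₂)
    (hl₂ : ∀ i, 0 ≤ l₂ i) {V₂ : Matrix b b ℂ} {m₂ : b → ℝ} (hB₂ : Dec (ptr A₂) V₂ m₂) (hm₂ : ∀ i, 0 < m₂ i)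
    (p q : ℝ) (hp : 0 ≤ p) (hq : 0 ≤ q) (eA : A = p • A₁ + q • A₂) :
    p * (∑ i, negMulLog (l₁ i) - ∑ i, negMulLog (m₁ i)) +
      q * (∑ i, negMulLog (l₂ i) - ∑ i, negMulLog (m₂ i)) ≤
      ∑ i, negMulLog (l i) - ∑ i, negMulLog (m i) := by
  have h := joint_conv hA hB.kron hl (fun x => hm x.2) hA₁ hB₁.kron hl₁ (fun x => hm₁ x.2)
    hA₂ hB₂.kron hl₂ (fun x => hm₂ x.2) p q hp hq eA (by
      rw [eA, ptr_lin, kronecker_add, kronecker_smul, kronecker_smul])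
  rw [hA.DD_cond hB, hA₁.DD_cond hB₁, hA₂.DD_cond hB₂, eA, ptr_lin] at h
  simp only [trace_add, trace_smul, Complex.add_re, Complex.smul_re, smul_eq_mul] at h
  linarith

theorem cond_concave [Nonempty a] {A U : Matrix (a × b) (a × b) ℂ} {l : a × b → ℝ} (hA : Dec A U l)
    (hl : ∀ i, 0 ≤ l i) {V : Matrix b b ℂ} {m : b → ℝ} (hB : Dec (ptr A) V m) (hm : ∀ i, 0 ≤ m i)
    {A₁ U₁ : Matrix (a × b) (a × b) ℂ} {l₁ : a × b → ℝ} (hA₁ : Dec A₁ U₁ l₁)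
    (hl₁ : ∀ i, 0 ≤ l₁ i) {V₁ : Matrix b b ℂ} {m₁ : b → ℝ} (hB₁ : Dec (ptr A₁) V₁ m₁) (hm₁ : ∀ i, 0 ≤ m₁ i)
    {A₂ U₂ : Matrix (a × b) (a × b) ℂ} {l₂ : a × b → ℝ} (hA₂ : Dec A₂ U₂ l₂)
    (hl₂ : ∀ i, 0 ≤ l₂ i) {V₂ : Matrix b b ℂ} {m₂ : b → ℝ} (hB₂ : Dec (ptr A₂) V₂ m₂) (hm₂ : ∀ i, 0 ≤ m₂ i)
    (p q : ℝ) (hp : 0 ≤ p) (hq : 0 ≤ q) (hpq : p + q = 1) (eA : A = p • A₁ + q • A₂) :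
    p * (∑ i, negMulLog (l₁ i) - ∑ i, negMulLog (m₁ i)) +
      q * (∑ i, negMulLog (l₂ i) - ∑ i, negMulLog (m₂ i)) ≤
      ∑ i, negMulLog (l i) - ∑ i, negMulLog (m i) := by
  obtain ⟨c, hc⟩ : ∃ c : ℝ, c = (Fintype.card a : ℝ) := ⟨_, rfl⟩
  have hc0 : 0 < c := by rw [hc]; exact_mod_cast Fintype.card_pos
  have := lim_le (((ent_cont l₁ 1).sub (ent_cont m₁ c)).const_mul p |>.add
    (((ent_cont l₂ 1).sub (ent_cont m₂ c)).const_mul q)) ((ent_cont l 1).sub (ent_cont m c)) ?_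
  · simpa using this
  intro e he
  simp only [one_mul]
  have hce : 0 < c * e := by positivity
  have hB' := hB.add_eps (c * e)
  have hB₁' := hB₁.add_eps (c * e)
  have hB₂' := hB₂.add_eps (c * e)
  rw [hc, ← ptr_eps, ← hc] at hB' hB₁' hB₂'
  refine cond_concave_pos (hA.add_eps e) (fun i => by linarith [hl i]) hB' (fun i => by linarith [hm i])
    (hA₁.add_eps e) (fun i => by linarith [hl₁ i]) hB₁' (fun i => by linarith [hm₁ i])
    (hA₂.add_eps e) (fun i => by linarith [hl₂ i]) hB₂' (fun i => by linarith [hm₂ i]) p q hp hq ?_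
  have hq' : q = 1 - p := by linarith
  rw [eA, hq']
  module

lemma vn_eq {n : Type*} [Fintype n] [DecidableEq n] {A : Matrix n n ℂ} (h : A.PosSemidef) :
    vnEntropy A = ∑ i, negMulLog (h.1.eigenvalues i) := by
  rw [vnEntropy, dif_pos h.1]

lemma ptr_trace (A : Matrix (a × b) (a × b) ℂ) : trace (ptr A) = trace A := by
  simp only [trace, Matrix.diag, ptr, Fintype.sum_prod_type]
  rw [Finset.sum_comm]

/-- Both bounds for the conditional entropy. -/
theorem cond_bounds [Nonempty a] {A₁ A₂ : Matrix (a × b) (a × b) ℂ} (h₁ : IsState A₁) (h₂ : IsState A₂)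
    (p : ℝ) (hp : 0 ≤ p) (hq : 0 ≤ 1 - p) :
    p * (vnEntropy A₁ - vnEntropy (ptr A₁)) + (1 - p) * (vnEntropy A₂ - vnEntropy (ptr A₂)) ≤
      vnEntropy (p • A₁ + (1 - p) • A₂) - vnEntropy (ptr (p • A₁ + (1 - p) • A₂)) ∧
    vnEntropy (p • A₁ + (1 - p) • A₂) - vnEntropy (ptr (p • A₁ + (1 - p) • A₂)) ≤
      p * (vnEntropy A₁ - vnEntropy (ptr A₁)) + (1 - p) * (vnEntropy A₂ - vnEntropy (ptr A₂))
        + binEntropy p := by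
  have hA : (p • A₁ + (1 - p) • A₂).PosSemidef := (h₁.1.smul hp).add (h₂.1.smul hq)
  rw [vn_eq h₁.1, vn_eq h₂.1, vn_eq hA, vn_eq (ptr_psd h₁.1), vn_eq (ptr_psd h₂.1), vn_eq (ptr_psd hA)]
  constructor
  · exact cond_concave (Dec.of_herm _) hA.eigenvalues_nonneg (Dec.of_herm _)
      (ptr_psd hA).eigenvalues_nonneg (Dec.of_herm _) h₁.1.eigenvalues_nonneg (Dec.of_herm _)
      (ptr_psd h₁.1).eigenvalues_nonneg (Dec.of_herm _) h₂.1.eigenvalues_nonneg (Dec.of_herm _)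
      (ptr_psd h₂.1).eigenvalues_nonneg p (1 - p) hp hq (by ring) rfl
  · have e1 := ent_upper (Dec.of_herm hA.1) hA.eigenvalues_nonneg (Dec.of_herm h₁.1.1)
      h₁.1.eigenvalues_nonneg (Dec.of_herm h₂.1.1) h₂.1.eigenvalues_nonneg h₁.2 h₂.2 p hp hq rfl
    have e2 := ent_concave (Dec.of_herm (ptr_psd hA).1) (ptr_psd hA).eigenvalues_nonneg
      (Dec.of_herm (ptr_psd h₁.1).1) (ptr_psd h₁.1).eigenvalues_nonneg
      (Dec.of_herm (ptr_psd h₂.1).1) (ptr_psd h₂.1).eigenvalues_nonneg p (1 - p) hp hq (by ring)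
      (ptr_lin _ _ _ _)
    linarith
end

lemma margAC_state {ρ : Matrix (α × β × γ) (α × β × γ) ℂ} (h : IsState ρ) : IsState (margAC ρ) := by
  constructor
  · have : margAC ρ = ∑ k : β, ρ.submatrix (fun x : α × γ => (x.1, k, x.2)) (fun x => (x.1, k, x.2)) := by
      ext i j; simp [margAC, Matrix.sum_apply]
    rw [this]
    exact posSemidef_sum _ fun k _ => h.1.submatrix _
  · rw [← h.2]
    simp only [trace, Matrix.diag, margAC, Fintype.sum_prod_type]
    refine Finset.sum_congr rfl fun i _ => ?_
    rw [Finset.sum_comm]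

theorem qcmi_almost_convexity (ρ σ : Matrix (α × β × γ) (α × β × γ) ℂ)
    (hρ : IsState ρ) (hσ : IsState σ) (p : ℝ) (hp0 : 0 < p) (hp1 : p < 1) :
    |p * qcmi ρ + (1 - p) * qcmi σ - qcmi (p • ρ + (1 - p) • σ)| ≤ Real.binEntropy p := by
  have hne : Nonempty α := by
    by_contra hcon
    rw [not_nonempty_iff] at hcon
    have := hρ.2
    simp [trace] at this
  have hq : 0 ≤ 1 - p := by linarith
  obtain ⟨a1, a2⟩ := cond_bounds hρ hσ p hp0.le hq
  obtain ⟨b1, b2⟩ := cond_bounds (margAC_state hρ) (margAC_state hσ) p hp0.le hq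
  have hlin : margAC (p • ρ + (1 - p) • σ) = p • margAC ρ + (1 - p) • margAC σ := by
    ext i j
    simp [margAC, Finset.sum_add_distrib, Finset.mul_sum]
  rw [← hlin] at b1 b2
  have hBC : ∀ τ : Matrix (α × β × γ) (α × β × γ) ℂ, ptr τ = margBC τ := fun _ => rfl
  have hC : ∀ τ : Matrix (α × β × γ) (α × β × γ) ℂ, ptr (margAC τ) = margC τ := fun _ => rfl
  simp only [hBC, hC] at a1 a2 b1 b2
  unfold qcmi
  rw [abs_le]
  constructor <;> linarith
end
end

section
/- Fannes-type continuity bound for the Holevo quantity: for two ensembles {pᵢ, ρᵢ}ᵢ₌₁ᵐ and {qᵢ, σᵢ}ᵢ₌₁ᵐ of density operators on a finite-dimensional space with ε₀ = (1/2)·Σᵢ ‖pᵢρᵢ − qᵢσᵢ‖₁, one has |χ({pᵢ,ρᵢ}) − χ({qᵢ,σᵢ})| ≤ ε₀·log m + 2g(ε₀), where χ denotes the Holevo quantity and g(ε) = (1+ε)·log(1+ε) − ε·log ε. -/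
set_option maxHeartbeats 1000000

open Matrix Real
open scoped ComplexOrder

noncomputable section

/-- The Holevo quantity χ({pᵢ,ρᵢ}) = H(Σᵢ pᵢρᵢ) − Σᵢ pᵢ H(ρᵢ). -/
def holevo {ι n : Type*} [Fintype ι] [Fintype n] [DecidableEq n]
    (p : ι → ℝ) (ρ : ι → Matrix n n ℂ) : ℝ :=
  vnEntropy (∑ i, p i • ρ i) - ∑ i, p i * vnEntropy (ρ i)

/-- g(ε) = (1+ε)·log(1+ε) − ε·log ε. -/
def gFun (x : ℝ) : ℝ := (1 + x) * Real.log (1 + x) - x * Real.log x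

namespace HolevoAux

/-! ### Scalar inequalities -/

/-- A tangent line bound for `a * log (s / a)`. -/
lemma tangent_aux {a s A S : ℝ} (ha : 0 ≤ a) (has : a ≤ s) (haA : a ≤ A) (hsS : s ≤ S) :
    a * (Real.log s - Real.log a + Real.log A - Real.log S) ≤ s * A / S - a := by
  rcases ha.eq_or_lt with h | h
  · subst h
    have : 0 ≤ s * A / S := div_nonneg (mul_nonneg has haA) (has.trans hsS)
    simpa using this
  · have hs : 0 < s := h.trans_le has
    have hA : 0 < A := h.trans_le haA
    have hS : 0 < S := hs.trans_le hsS
    have hpos : 0 < s * A / (a * S) := by positivity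
    have h1 := Real.log_le_sub_one_of_pos hpos
    rw [Real.log_div (by positivity) (by positivity), Real.log_mul hs.ne' hA.ne',
      Real.log_mul h.ne' hS.ne'] at h1
    have h2 := mul_le_mul_of_nonneg_left h1 ha
    have h3 : a * (s * A / (a * S) - 1) = s * A / S - a := by field_simp
    linarith [h3, h2, show a * (Real.log s - Real.log a + Real.log A - Real.log S) =
      a * (Real.log s + Real.log A - (Real.log a + Real.log S)) by ring]

/-- The (unnormalised) binary entropy. -/
def dEnt (a b : ℝ) : ℝ := negMulLog a + negMulLog b - negMulLog (a + b)

lemma dEnt_tangent {a b A B : ℝ} (ha : 0 ≤ a) (hb : 0 ≤ b) (haA : a ≤ A) (hbB : b ≤ B) :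
    dEnt a b ≤ a * (Real.log (A + B) - Real.log A) + b * (Real.log (A + B) - Real.log B) := by
  have h1 := tangent_aux (s := a + b) (S := A + B) ha (by linarith) haA (by linarith)
  have h2 := tangent_aux (s := a + b) (S := A + B) hb (by linarith) hbB (by linarith)
  have h3 : (a + b) * A / (A + B) + (a + b) * B / (A + B) = a + b := by
    by_cases h : A + B = 0
    · have : a + b = 0 := by linarith
      simp [this]
    · field_simp
  simp only [dEnt, negMulLog]
  linarith

lemma sum_dEnt_le {ι : Type*} (s : Finset ι) (a b : ι → ℝ) (ha : ∀ i, 0 ≤ a i)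
    (hb : ∀ i, 0 ≤ b i) :
    ∑ i ∈ s, dEnt (a i) (b i) ≤ dEnt (∑ i ∈ s, a i) (∑ i ∈ s, b i) := by
  have h : ∀ i ∈ s, dEnt (a i) (b i) ≤ _ := fun i hi =>
    dEnt_tangent (ha i) (hb i) (Finset.single_le_sum (fun j _ => ha j) hi)
      (Finset.single_le_sum (fun j _ => hb j) hi)
  refine (Finset.sum_le_sum h).trans (le_of_eq ?_)
  rw [Finset.sum_add_distrib, ← Finset.sum_mul, ← Finset.sum_mul]
  simp only [dEnt, negMulLog]
  ring

lemma sum_negMulLog_le {m : ℕ} (a : Fin m → ℝ) (ha : ∀ i, 0 ≤ a i) :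
    ∑ i, negMulLog (a i) ≤ negMulLog (∑ i, a i) + (∑ i, a i) * Real.log m := by
  rcases Nat.eq_zero_or_pos m with h | h
  · subst h; simp
  have hm : (0 : ℝ) < m := by exact_mod_cast h
  set A := ∑ i, a i with hA
  have key : ∀ i ∈ Finset.univ, negMulLog (a i) ≤
      a i * (Real.log m - Real.log A) + A / m - a i := by
    intro i _
    have hAi : a i ≤ A := Finset.single_le_sum (fun j _ => ha j) (Finset.mem_univ i)
    rcases (ha i).eq_or_lt with h0 | h0
    · have : 0 ≤ A / m := div_nonneg ((ha i).trans hAi) hm.le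
      simp [← h0, this]
    · have hA0 : 0 < A := h0.trans_le hAi
      have h1 := Real.log_le_sub_one_of_pos (show 0 < A / (a i * m) by positivity)
      rw [Real.log_div hA0.ne' (by positivity), Real.log_mul h0.ne' hm.ne'] at h1
      have h2 := mul_le_mul_of_nonneg_left h1 h0.le
      have h3 : a i * (A / (a i * m) - 1) = A / m - a i := by field_simp
      simp only [negMulLog]
      linarith
  refine (Finset.sum_le_sum key).trans (le_of_eq ?_)
  rw [Finset.sum_sub_distrib, Finset.sum_add_distrib, ← Finset.sum_mul, ← hA]
  simp only [negMulLog, Finset.sum_const, Finset.card_univ, Fintype.card_fin, nsmul_eq_mul]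
  field_simp
  ring

/-! ### Spectral lemmas -/

variable {n : Type*} [Fintype n] [DecidableEq n]

lemma spectral {A : Matrix n n ℂ} (hA : A.IsHermitian) :
    ∃ U : Matrix n n ℂ, U * Uᴴ = 1 ∧ Uᴴ * U = 1 ∧
      A = U * diagonal (fun i => (hA.eigenvalues i : ℂ)) * Uᴴ := by
  refine ⟨hA.eigenvectorUnitary, ?_, ?_, ?_⟩
  · exact Unitary.coe_mul_star_self _
  · exact Unitary.coe_star_mul_self _
  · exact hA.spectral_theorem

lemma sum_eig_eq_roots {A : Matrix n n ℂ} (hA : A.IsHermitian) (f : ℝ → ℝ) :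
    ∑ i, f (hA.eigenvalues i) = (A.charpoly.roots.map (fun z => f z.re)).sum := by
  rw [hA.roots_charpoly_eq_eigenvalues]
  simp [Multiset.map_map, Function.comp_def]

lemma sum_eig_of_diag {A U : Matrix n n ℂ} (hA : A.IsHermitian) (hU : Uᴴ * U = 1) (d : n → ℝ)
    (h : A = U * diagonal (fun i => (d i : ℂ)) * Uᴴ) (f : ℝ → ℝ) :
    ∑ i, f (hA.eigenvalues i) = ∑ i, f (d i) := by
  rw [sum_eig_eq_roots hA]
  have : A.charpoly = ∏ i, (Polynomial.X - Polynomial.C (d i : ℂ)) := by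
    rw [h, Matrix.charpoly_mul_comm, ← mul_assoc, hU, one_mul, charpoly_diagonal]
  have h2 : (∏ i, (Polynomial.X - Polynomial.C (d i : ℂ))) =
      ((Finset.univ.val.map (fun i => (d i : ℂ))).map
        (fun a => Polynomial.X - Polynomial.C a)).prod := by
    rw [Multiset.map_map]; rfl
  rw [this, h2, Polynomial.roots_multiset_prod_X_sub_C]
  simp [Multiset.map_map]

lemma vnEntropy_eq {A : Matrix n n ℂ} (hA : A.IsHermitian) :
    vnEntropy A = ∑ i, negMulLog (hA.eigenvalues i) := by
  simp [vnEntropy, hA]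

lemma herm_diag (U : Matrix n n ℂ) (d : n → ℝ) :
    (U * diagonal (fun i => (d i : ℂ)) * Uᴴ).IsHermitian := by
  apply isHermitian_mul_mul_conjTranspose
  rw [isHermitian_diagonal_iff]
  intro i
  simp [isSelfAdjoint_iff]

lemma psd_diag (U : Matrix n n ℂ) (d : n → ℝ) (hd : ∀ i, 0 ≤ d i) :
    (U * diagonal (fun i => (d i : ℂ)) * Uᴴ).PosSemidef := by
  apply PosSemidef.mul_mul_conjTranspose_same
  rw [posSemidef_diagonal_iff]
  intro i
  exact_mod_cast hd i

lemma trace_diag (U : Matrix n n ℂ) (hU : Uᴴ * U = 1) (d : n → ℝ) :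
    (U * diagonal (fun i => (d i : ℂ)) * Uᴴ).trace.re = ∑ i, d i := by
  rw [Matrix.trace_mul_comm, ← mul_assoc, hU, one_mul, trace_diagonal]
  simp

/-- Peierls' inequality in a unitary basis. -/
lemma peierls {A : Matrix n n ℂ} (hA : A.PosSemidef) (W : Matrix n n ℂ) (hW : W * Wᴴ = 1)
    (hW' : Wᴴ * W = 1) :
    vnEntropy A ≤ ∑ j, negMulLog ((Wᴴ * A * W) j j).re := by
  obtain ⟨U, h1, h2, h3⟩ := spectral hA.1
  rw [vnEntropy_eq hA.1]
  set a := hA.1.eigenvalues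
  have ha : ∀ i, 0 ≤ a i := hA.eigenvalues_nonneg
  set V := Wᴴ * U with hV
  have hV1 : V * Vᴴ = 1 := by
    rw [hV, conjTranspose_mul, conjTranspose_conjTranspose, mul_assoc, ← mul_assoc U, h1, one_mul,
      hW']
  have hV2 : Vᴴ * V = 1 := by
    rw [hV, conjTranspose_mul, conjTranspose_conjTranspose, mul_assoc, ← mul_assoc W, hW, one_mul,
      h2]
  have hrow : ∀ j, ∑ k, Complex.normSq (V j k) = 1 := by
    intro j
    have := congrFun (congrFun hV1 j) j
    simp only [mul_apply, conjTranspose_apply, one_apply_eq] at this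
    have h := congrArg Complex.re this
    simpa [Complex.mul_conj, ← Complex.ofReal_sum] using h
  have hcol : ∀ k, ∑ j, Complex.normSq (V j k) = 1 := by
    intro j
    have := congrFun (congrFun hV2 j) j
    simp only [mul_apply, conjTranspose_apply, one_apply_eq] at this
    have h := congrArg Complex.re this
    simpa [mul_comm, Complex.mul_conj, ← Complex.ofReal_sum] using h
  have hd : ∀ j, ((Wᴴ * A * W) j j).re = ∑ k, Complex.normSq (V j k) * a k := by
    intro j
    have : Wᴴ * A * W = V * diagonal (fun i => (a i : ℂ)) * Vᴴ := by
      rw [hV, conjTranspose_mul, conjTranspose_conjTranspose]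
      nth_rewrite 1 [h3]
      simp only [mul_assoc]
    rw [this, mul_apply]
    simp only [mul_diagonal, conjTranspose_apply, Complex.re_sum]
    refine Finset.sum_congr rfl fun k _ => ?_
    simp [Complex.normSq_apply]
    ring
  calc ∑ k, negMulLog (a k) = ∑ k, ∑ j, Complex.normSq (V j k) * negMulLog (a k) := by
        refine Finset.sum_congr rfl fun k _ => ?_
        rw [← Finset.sum_mul, hcol, one_mul]
    _ = ∑ j, ∑ k, Complex.normSq (V j k) * negMulLog (a k) := Finset.sum_comm
    _ ≤ _ := by
        refine Finset.sum_le_sum fun j _ => ?_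
        rw [hd j]
        have := Real.concaveOn_negMulLog.le_map_sum (t := Finset.univ)
          (w := fun k => Complex.normSq (V j k)) (p := a) (fun k _ => Complex.normSq_nonneg _)
          (hrow j) (fun k _ => ha k)
        simpa using this

lemma trace_re_nonneg {A : Matrix n n ℂ} (hA : A.PosSemidef) : 0 ≤ A.trace.re :=
  (Complex.nonneg_iff.mp hA.trace_nonneg).1

/-- Entropy minus the entropy of the trace. -/
def tEnt (A : Matrix n n ℂ) : ℝ := vnEntropy A - negMulLog A.trace.re

/-- Concavity of the entropy in homogeneous form. -/
lemma tEnt_add {A B : Matrix n n ℂ} (hA : A.PosSemidef) (hB : B.PosSemidef) :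
    tEnt A + tEnt B ≤ tEnt (A + B) := by
  have hC := hA.add hB
  obtain ⟨U, h1, h2, h3⟩ := spectral hC.1
  have pA := peierls hA U h1 h2
  have pB := peierls hB U h1 h2
  have dA : ∀ j, 0 ≤ ((Uᴴ * A * U) j j).re := fun j =>
    (Complex.nonneg_iff.mp (hA.conjTranspose_mul_mul_same U).diag_nonneg).1
  have dB : ∀ j, 0 ≤ ((Uᴴ * B * U) j j).re := fun j =>
    (Complex.nonneg_iff.mp (hB.conjTranspose_mul_mul_same U).diag_nonneg).1
  have tr : ∀ M : Matrix n n ℂ, ∑ j, ((Uᴴ * M * U) j j).re = M.trace.re := by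
    intro M
    rw [← Complex.re_sum]
    change (Uᴴ * M * U).trace.re = _
    rw [Matrix.trace_mul_comm, ← mul_assoc, h1, one_mul]
  have hdiag : Uᴴ * (A + B) * U = diagonal (fun i => (hC.1.eigenvalues i : ℂ)) := by
    nth_rewrite 1 [h3]
    rw [← mul_assoc, ← mul_assoc, h2, one_mul, mul_assoc, h2, mul_one]
  have hS : vnEntropy (A + B) = ∑ j, negMulLog (((Uᴴ * A * U) j j).re + ((Uᴴ * B * U) j j).re) := by
    rw [vnEntropy_eq hC.1]
    refine Finset.sum_congr rfl fun j _ => ?_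
    have := congrArg Complex.re (congrFun (congrFun hdiag j) j)
    rw [mul_add, add_mul] at this
    simp only [Matrix.add_apply, Complex.add_re, diagonal_apply_eq, Complex.ofReal_re] at this
    rw [this]
  have := sum_dEnt_le Finset.univ _ _ dA dB
  rw [tr, tr] at this
  simp only [dEnt, Finset.sum_sub_distrib, Finset.sum_add_distrib] at this
  simp only [tEnt, hS, trace_add, Complex.add_re]
  linarith

lemma vnEntropy_mul_comm {l : Type*} [Fintype l] [DecidableEq l] (W : Matrix n l ℂ) :
    vnEntropy (W * Wᴴ) = vnEntropy (Wᴴ * W) := by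
  rw [vnEntropy_eq (posSemidef_self_mul_conjTranspose W).1,
    vnEntropy_eq (posSemidef_conjTranspose_mul_self W).1, sum_eig_eq_roots, sum_eig_eq_roots]
  have h := congrArg (fun P : Polynomial ℂ => (P.roots.map (fun z => negMulLog z.re)).sum)
    (Matrix.charpoly_mul_comm' W Wᴴ)
  have hne : ∀ (k : ℕ) (P : Polynomial ℂ), P.Monic → Polynomial.X ^ k * P ≠ 0 := fun k P hP =>
    mul_ne_zero (pow_ne_zero _ Polynomial.X_ne_zero) hP.ne_zero
  rw [Polynomial.roots_mul (hne _ _ (charpoly_monic _)),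
    Polynomial.roots_mul (hne _ _ (charpoly_monic _))] at h
  simpa [Multiset.map_nsmul, Multiset.sum_nsmul] using h

/-- Subadditivity of the unnormalised entropy. -/
lemma vnEntropy_add_le {A B : Matrix n n ℂ} (hA : A.PosSemidef) (hB : B.PosSemidef) :
    vnEntropy (A + B) ≤ vnEntropy A + vnEntropy B := by
  have key : ∀ {A : Matrix n n ℂ} (hA : A.PosSemidef), ∃ X : Matrix n n ℂ, X * Xᴴ = A ∧
      ∑ j, negMulLog ((Xᴴ * X) j j).re = vnEntropy A := by
    intro A hA
    obtain ⟨U, h1, h2, h3⟩ := spectral hA.1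
    have ha : ∀ i, 0 ≤ hA.1.eigenvalues i := hA.eigenvalues_nonneg
    have hsq : diagonal (fun i => (Real.sqrt (hA.1.eigenvalues i) : ℂ)) *
        (diagonal (fun i => (Real.sqrt (hA.1.eigenvalues i) : ℂ)))ᴴ =
        diagonal (fun i => (hA.1.eigenvalues i : ℂ)) := by
      rw [diagonal_conjTranspose, diagonal_mul_diagonal]
      congr 1
      ext i
      simp [← Complex.ofReal_mul, Real.mul_self_sqrt (ha i)]
    refine ⟨U * diagonal (fun i => (Real.sqrt (hA.1.eigenvalues i) : ℂ)), ?_, ?_⟩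
    · rw [conjTranspose_mul, mul_assoc, ← mul_assoc (diagonal _), hsq, ← mul_assoc]
      exact h3.symm
    · rw [vnEntropy_eq hA.1]
      refine Finset.sum_congr rfl fun j _ => ?_
      rw [conjTranspose_mul, mul_assoc, ← mul_assoc Uᴴ, h2, one_mul, diagonal_conjTranspose,
        diagonal_mul_diagonal, diagonal_apply_eq]
      simp [← Complex.ofReal_mul, Real.mul_self_sqrt (ha j)]
  obtain ⟨X, hX, hX'⟩ := key hA
  obtain ⟨Y, hY, hY'⟩ := key hB
  have hW : fromCols X Y * (fromCols X Y)ᴴ = A + B := by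
    rw [conjTranspose_fromCols_eq_fromRows_conjTranspose, fromCols_mul_fromRows, hX, hY]
  have hp := peierls (posSemidef_conjTranspose_mul_self (fromCols X Y)) 1 (by simp) (by simp)
  rw [← hW, vnEntropy_mul_comm]
  refine hp.trans (le_of_eq ?_)
  rw [← hX', ← hY', conjTranspose_one, one_mul, mul_one,
    conjTranspose_fromCols_eq_fromRows_conjTranspose, fromRows_mul_fromCols, Fintype.sum_sum_type]
  simp

lemma vnEntropy_smul {A : Matrix n n ℂ} (hA : A.IsHermitian) (c : ℝ) :
    vnEntropy (c • A) = c * vnEntropy A + negMulLog c * A.trace.re := by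
  obtain ⟨U, h1, h2, h3⟩ := spectral hA
  have h4 : c • A = U * diagonal (fun i => ((c * hA.eigenvalues i : ℝ) : ℂ)) * Uᴴ := by
    have : diagonal (fun i => ((c * hA.eigenvalues i : ℝ) : ℂ)) =
        c • diagonal (fun i => (hA.eigenvalues i : ℂ)) := by
      ext i j
      by_cases h : i = j
      · subst h; simp
      · simp [h]
    rw [this, Matrix.mul_smul, Matrix.smul_mul, ← h3]
  have hc : (c • A).IsHermitian := h4 ▸ herm_diag _ _
  have ht : A.trace.re = ∑ i, hA.eigenvalues i := by
    conv_lhs => rw [h3]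
    exact trace_diag U h2 _
  rw [vnEntropy_eq hc, sum_eig_of_diag hc h2 _ h4, vnEntropy_eq hA, ht]
  simp only [negMulLog_mul, Finset.sum_add_distrib, Finset.mul_sum]
  rw [add_comm]
  congr 1
  exact Finset.sum_congr rfl fun i _ => mul_comm _ _

/-- Jordan decomposition and trace norm. -/
lemma jordan {X : Matrix n n ℂ} (hX : X.IsHermitian) :
    ∃ P N : Matrix n n ℂ, P.PosSemidef ∧ N.PosSemidef ∧ X = P - N ∧
      traceNorm X = P.trace.re + N.trace.re := by
  obtain ⟨U, h1, h2, h3⟩ := spectral hX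
  set l := hX.eigenvalues
  refine ⟨U * diagonal (fun i => (((l i)⁺ : ℝ) : ℂ)) * Uᴴ, U * diagonal (fun i => (((l i)⁻ : ℝ) : ℂ)) * Uᴴ,
    psd_diag _ _ fun i => posPart_nonneg _, psd_diag _ _ fun i => negPart_nonneg _, ?_, ?_⟩
  · rw [← sub_mul, ← mul_sub, diagonal_sub]
    simp only [← Complex.ofReal_sub, posPart_sub_negPart]
    exact h3
  · rw [trace_diag _ h2, trace_diag _ h2, ← Finset.sum_add_distrib]
    simp only [posPart_add_negPart]
    have h4 : Xᴴ * X = U * diagonal (fun i => ((l i ^ 2 : ℝ) : ℂ)) * Uᴴ := by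
      rw [hX.eq]
      nth_rewrite 1 [h3]
      nth_rewrite 1 [h3]
      have : diagonal (fun i => ((l i ^ 2 : ℝ) : ℂ)) =
        diagonal (fun i => (l i : ℂ)) * diagonal (fun i => (l i : ℂ)) := by
        rw [diagonal_mul_diagonal]
        congr 1
        ext i
        push_cast
        ring
      rw [this]
      simp only [mul_assoc]
      rw [← mul_assoc Uᴴ U, h2, one_mul]
    have h5 := sum_eig_of_diag (posSemidef_conjTranspose_mul_self X).1 h2 _ h4 Real.sqrt
    rw [traceNorm, h5]
    simp [Real.sqrt_sq_eq_abs]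

/-! ### The homogeneous Holevo functional -/

variable {ι : Type*} [Fintype ι]

/-- Holevo functional of unnormalised ensembles. -/
def hol (A : ι → Matrix n n ℂ) : ℝ := tEnt (∑ i, A i) - ∑ i, tEnt (A i)

lemma tEnt_zero : tEnt (0 : Matrix n n ℂ) = 0 := by
  have := vnEntropy_smul (isHermitian_zero (n := n) (α := ℂ)) 0
  simp at this
  simp [tEnt, this]

lemma vnEntropy_zero : vnEntropy (0 : Matrix n n ℂ) = 0 := by
  simpa [tEnt] using tEnt_zero (n := n)

lemma psd_sum (s : Finset ι) {A : ι → Matrix n n ℂ} (hA : ∀ i, (A i).PosSemidef) :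
    (∑ i ∈ s, A i).PosSemidef := posSemidef_sum s fun i _ => hA i

lemma hol_nonneg {A : ι → Matrix n n ℂ} (hA : ∀ i, (A i).PosSemidef) : 0 ≤ hol A := by
  classical
  have : ∀ s : Finset ι, ∑ i ∈ s, tEnt (A i) ≤ tEnt (∑ i ∈ s, A i) := by
    intro s
    induction s using Finset.induction_on with
    | empty => simp [tEnt_zero]
    | insert a s ha ih =>
      rw [Finset.sum_insert ha, Finset.sum_insert ha]
      exact (add_le_add_right ih _).trans (tEnt_add (hA a) (psd_sum s hA))
  exact sub_nonneg.mpr (this _)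

lemma hol_le {m : ℕ} {A : Fin m → Matrix n n ℂ} (hA : ∀ i, (A i).PosSemidef) :
    hol A ≤ (∑ i, (A i).trace.re) * Real.log m := by
  have : ∀ s : Finset (Fin m), vnEntropy (∑ i ∈ s, A i) ≤ ∑ i ∈ s, vnEntropy (A i) := by
    intro s
    induction s using Finset.induction_on with
    | empty => simp [vnEntropy_zero]
    | insert a s ha ih =>
      rw [Finset.sum_insert ha, Finset.sum_insert ha]
      exact (vnEntropy_add_le (hA a) (psd_sum s hA)).trans (add_le_add_right ih _)
  have h1 := this Finset.univ
  have h2 := sum_negMulLog_le _ fun i => trace_re_nonneg (hA i)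
  simp only [hol, tEnt, Finset.sum_sub_distrib, trace_sum, Complex.re_sum]
  linarith

lemma tEnt_add_le {A B : Matrix n n ℂ} (hA : A.PosSemidef) (hB : B.PosSemidef) :
    tEnt (A + B) ≤ tEnt A + tEnt B + dEnt A.trace.re B.trace.re := by
  have := vnEntropy_add_le hA hB
  simp only [tEnt, dEnt, trace_add, Complex.add_re]
  linarith

lemma sum_tEnt_add_le {A B : ι → Matrix n n ℂ} (hA : ∀ i, (A i).PosSemidef)
    (hB : ∀ i, (B i).PosSemidef) :
    ∑ i, tEnt (A i + B i) ≤ ∑ i, tEnt (A i) + ∑ i, tEnt (B i) +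
      dEnt (∑ i, (A i).trace.re) (∑ i, (B i).trace.re) := by
  have h1 := Finset.sum_le_sum fun i (_ : i ∈ Finset.univ) => tEnt_add_le (hA i) (hB i)
  have h2 := sum_dEnt_le Finset.univ _ _ (fun i => trace_re_nonneg (hA i))
    (fun i => trace_re_nonneg (hB i))
  simp only [Finset.sum_add_distrib] at h1
  linarith

lemma hol_add_ge {A B : ι → Matrix n n ℂ} (hA : ∀ i, (A i).PosSemidef)
    (hB : ∀ i, (B i).PosSemidef) :
    hol A + hol B - dEnt (∑ i, (A i).trace.re) (∑ i, (B i).trace.re) ≤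
      hol (fun i => A i + B i) := by
  have h1 := sum_tEnt_add_le hA hB
  have h2 := tEnt_add (psd_sum Finset.univ hA) (psd_sum Finset.univ hB)
  simp only [hol, Finset.sum_add_distrib]
  linarith

lemma hol_add_le {A B : ι → Matrix n n ℂ} (hA : ∀ i, (A i).PosSemidef)
    (hB : ∀ i, (B i).PosSemidef) :
    hol (fun i => A i + B i) ≤
      hol A + hol B + dEnt (∑ i, (A i).trace.re) (∑ i, (B i).trace.re) := by
  have h1 := Finset.sum_le_sum fun i (_ : i ∈ Finset.univ) => tEnt_add (hA i) (hB i)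
  have h2 := tEnt_add_le (psd_sum Finset.univ hA) (psd_sum Finset.univ hB)
  simp only [trace_sum, Complex.re_sum, Finset.sum_add_distrib] at h1 h2
  simp only [hol, Finset.sum_add_distrib]
  linarith

lemma psd_smul {A : Matrix n n ℂ} (hA : A.PosSemidef) {c : ℝ} (hc : 0 ≤ c) :
    (c • A).PosSemidef := by
  have : c • A = (c : ℂ) • A := by ext; simp
  rw [this]
  exact hA.smul (by exact_mod_cast hc)

lemma holevo_eq_hol {p : ι → ℝ} {ρ : ι → Matrix n n ℂ} (hp1 : ∑ i, p i = 1)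
    (hρ : ∀ i, IsState (ρ i)) : holevo p ρ = hol (fun i => p i • ρ i) := by
  have ht : ∀ i, (p i • ρ i).trace.re = p i := fun i => by simp [trace_smul, (hρ i).2]
  have h1 : ∀ i, tEnt (p i • ρ i) = p i * vnEntropy (ρ i) := by
    intro i
    rw [tEnt, ht, vnEntropy_smul (hρ i).1.1, (hρ i).2]
    simp
  simp only [hol, holevo, h1]
  simp only [tEnt, trace_sum, Complex.re_sum, ht, hp1, negMulLog_one, sub_zero]

lemma one_sided {m : ℕ} {P Q D D' : Fin m → Matrix n n ℂ} {ε : ℝ}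
    (hP : ∀ i, (P i).PosSemidef) (hQ : ∀ i, (Q i).PosSemidef)
    (hD : ∀ i, (D i).PosSemidef) (hD' : ∀ i, (D' i).PosSemidef)
    (h : ∀ i, P i - Q i = D i - D' i)
    (tP : ∑ i, (P i).trace.re = 1) (tQ : ∑ i, (Q i).trace.re = 1)
    (tD : ∑ i, (D i).trace.re = ε) (tD' : ∑ i, (D' i).trace.re = ε) :
    hol P - hol Q ≤ ε * Real.log m + 2 * gFun ε := by
  have h1 := hol_add_ge hP hD'
  have h2 := hol_add_le hQ hD
  have h3 : (fun i => P i + D' i) = fun i => Q i + D i := by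
    funext i
    have := h i
    rw [sub_eq_sub_iff_add_eq_add] at this
    rw [this, add_comm]
  have h4 := hol_nonneg hD'
  have h5 := hol_le hD
  rw [h3, tP, tD'] at h1
  rw [tQ, tD] at h2
  rw [tD] at h5
  have h6 : dEnt 1 ε = gFun ε := by simp only [dEnt, gFun, negMulLog]; simp; ring
  rw [h6] at h1 h2
  linarith

end HolevoAux

theorem holevo_fannes_continuity_bound {n : Type*} [Fintype n] [DecidableEq n] (m : ℕ)
    (p q : Fin m → ℝ) (hp : ∀ i, 0 ≤ p i) (hp1 : ∑ i, p i = 1)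
    (hq : ∀ i, 0 ≤ q i) (hq1 : ∑ i, q i = 1)
    (ρ σ : Fin m → Matrix n n ℂ) (hρ : ∀ i, IsState (ρ i)) (hσ : ∀ i, IsState (σ i))
    (ε₀ : ℝ) (hε₀ : ε₀ = (∑ i, traceNorm (p i • ρ i - q i • σ i)) / 2) :
    |holevo p ρ - holevo q σ| ≤ ε₀ * Real.log m + 2 * gFun ε₀ := by
  have hP : ∀ i, (p i • ρ i).PosSemidef := fun i => HolevoAux.psd_smul (hρ i).1 (hp i)
  have hQ : ∀ i, (q i • σ i).PosSemidef := fun i => HolevoAux.psd_smul (hσ i).1 (hq i)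
  choose D D' hD hD' hsub htr using fun i => HolevoAux.jordan ((hP i).1.sub (hQ i).1)
  have tP : ∀ i, (p i • ρ i).trace.re = p i := fun i => by simp [trace_smul, (hρ i).2]
  have tQ : ∀ i, (q i • σ i).trace.re = q i := fun i => by simp [trace_smul, (hσ i).2]
  have e1 : ∑ i, (D i).trace.re - ∑ i, (D' i).trace.re = 0 := by
    rw [← Finset.sum_sub_distrib, ← sub_eq_zero.mpr (hp1.trans hq1.symm),
      ← Finset.sum_sub_distrib]
    refine Finset.sum_congr rfl fun i _ => ?_
    have := congrArg (fun M => (Matrix.trace M).re) (hsub i)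
    simp only [trace_sub, Complex.sub_re, tP, tQ] at this
    exact this.symm
  have e2 : ∑ i, (D i).trace.re + ∑ i, (D' i).trace.re = 2 * ε₀ := by
    rw [← Finset.sum_add_distrib, hε₀, ← Finset.sum_congr rfl fun i _ => htr i]
    ring
  have tD : ∑ i, (D i).trace.re = ε₀ := by linarith
  have tD' : ∑ i, (D' i).trace.re = ε₀ := by linarith
  have tP' : ∑ i, (p i • ρ i).trace.re = 1 := by rw [Finset.sum_congr rfl fun i _ => tP i, hp1]
  have tQ' : ∑ i, (q i • σ i).trace.re = 1 := by rw [Finset.sum_congr rfl fun i _ => tQ i, hq1]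
  rw [HolevoAux.holevo_eq_hol hp1 hρ, HolevoAux.holevo_eq_hol hq1 hσ, abs_le]
  have a1 := HolevoAux.one_sided hP hQ hD hD' hsub tP' tQ' tD tD'
  have a2 := HolevoAux.one_sided hQ hP hD' hD
    (fun i => by rw [← neg_sub, hsub i, neg_sub]) tQ' tP' tD' tD
  constructor <;> linarith
end
end
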